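/- arXiv:1410.1859 — 4 statements merged into one kernel-verified Lean document; each statement's English description precedes it below -/
import Mathlib

section
/- Moderate deviation asymptotics: let (n_j) be a sequence of natural numbers with n_j → ∞ and (x_j) a sequence of positive reals with x_j → ∞ and x_j³/√(n_j) → 0. Then μ({X ∈ 2^ℕ : S*_{n_j}(X) > x_j}) is asymptotically equivalent to exp(−x_j²/2)/(√(2π)·x_j); that is, the ratio of the two quantities tends to 1 as j → ∞. -/
open MeasureTheory Filter

/-- The sum of the first `n` coordinates of a point of Cantor space, as a real number. -/
noncomputable def coinSum (X : ℕ → Bool) (n : ℕ) : ℝ :=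
  ∑ i ∈ Finset.range n, ((X i).toNat : ℝ)

/-- `μ` is the fair-coin measure on Cantor space: the probability measure under which the
coordinates are i.i.d. Bernoulli(1/2), i.e. every finite cylinder determined by prescribing
the coordinates in a finite set `s` has measure `(1/2)^|s|`. -/
def IsFairCoin (μ : Measure (ℕ → Bool)) : Prop :=
  IsProbabilityMeasure μ ∧
    ∀ (s : Finset ℕ) (f : ℕ → Bool),
      μ {X | ∀ i ∈ s, X i = f i} = (1 / 2) ^ s.card
/-- The reduced number of heads in `n` tosses: `S*_n(X) = (S_n(X) − n/2) / √(n/4)`. -/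
noncomputable def reducedSum (X : ℕ → Bool) (n : ℕ) : ℝ :=
  (coinSum X n - n / 2) / Real.sqrt (n / 4)

noncomputable def bin (n k : ℕ) : ℝ := (n.choose k : ℝ) / 2 ^ n

open Classical in
lemma measure_coin (μ : Measure (ℕ → Bool)) (hμ : IsFairCoin μ) (n : ℕ) (P : ℝ → Prop) :
    (μ {X | P (coinSum X n)}).toReal =
      ∑ k ∈ Finset.range (n+1), if P (k:ℝ) then bin n k else 0 := by
  obtain ⟨hp, hc⟩ := hμ
  have hcyl : ∀ A ∈ (Finset.range n).powerset,
      μ {X : ℕ → Bool | ∀ i ∈ Finset.range n, X i = decide (i ∈ A)} = (1/2)^n := by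
    intro A hA
    have := hc (Finset.range n) (fun i => decide (i ∈ A))
    simpa using this
  have hcs : ∀ A ∈ (Finset.range n).powerset, ∀ X : ℕ → Bool,
      (∀ i ∈ Finset.range n, X i = decide (i ∈ A)) → coinSum X n = A.card := by
    intro A hA X hX
    unfold coinSum
    rw [Finset.sum_congr rfl (g := fun i => if i ∈ A then (1:ℝ) else 0)]
    · rw [← Finset.sum_filter, Finset.filter_mem_eq_inter,
        Finset.inter_eq_right.mpr (Finset.mem_powerset.mp hA)]
      simp
    · intro i hi
      rw [hX i hi]
      by_cases h : i ∈ A <;> simp [h]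
  have hset : {X : ℕ → Bool | P (coinSum X n)} =
      ⋃ A ∈ (Finset.range n).powerset.filter (fun A => P (A.card : ℝ)),
        {X : ℕ → Bool | ∀ i ∈ Finset.range n, X i = decide (i ∈ A)} := by
    ext X
    simp only [Set.mem_ofPred_eq, Set.mem_iUnion, Finset.mem_filter, exists_prop]
    constructor
    · intro h
      have hA : (Finset.range n).filter (fun i => X i = true) ∈ (Finset.range n).powerset := by
        simp
      have hX : ∀ i ∈ Finset.range n, X i = decide (i ∈ (Finset.range n).filter (fun i => X i = true)) := by
        intro i hi
        have := Finset.mem_range.mp hi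
        simp [this]
      refine ⟨_, ⟨hA, ?_⟩, hX⟩
      rw [← hcs _ hA X hX]; exact h
    · rintro ⟨A, ⟨hA, h⟩, hX⟩
      rw [hcs A hA X hX]; exact h
  rw [hset, measure_biUnion_finset]
  · rw [Finset.sum_congr rfl (g := fun _ => ((1:ENNReal)/2)^n)
      (fun A hA => hcyl A (Finset.mem_filter.mp hA).1)]
    rw [ENNReal.toReal_sum (by intro a _; finiteness)]
    rw [Finset.sum_filter]
    have := Finset.sum_powerset_apply_card (fun k => if P (k:ℝ) then ((1:ENNReal)/2^n).toReal else 0) (x := Finset.range n)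
    simp only [one_div, ENNReal.inv_pow] at this ⊢
    rw [this]
    simp only [Finset.card_range]
    apply Finset.sum_congr rfl
    intro k _
    split_ifs <;> simp [bin, div_eq_mul_inv]
  · intro A hA B hB hAB
    refine Set.disjoint_left.mpr ?_
    intro X hXA hXB
    apply hAB
    simp only [Finset.coe_filter, Finset.mem_powerset, Set.mem_ofPred_eq] at hA hB hXA hXB
    ext i
    by_cases hi : i ∈ Finset.range n
    · have h1 := hXA i hi
      rw [hXB i hi] at h1
      simpa using h1.symm
    · exact ⟨fun h => absurd (hA.1 h) hi, fun h => absurd (hB.1 h) hi⟩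
  · intro A _
    have : {X : ℕ → Bool | ∀ i ∈ Finset.range n, X i = decide (i ∈ A)} =
      ⋂ i ∈ Finset.range n, (fun X : ℕ → Bool => X i) ⁻¹' {decide (i ∈ A)} := by
      ext X; simp
    rw [this]
    exact Finset.measurableSet_biInter _ (fun i _ => measurable_pi_apply i (measurableSet_singleton _))

lemma tail_coin (μ : Measure (ℕ → Bool)) (hμ : IsFairCoin μ) (n : ℕ) (hn : 0 < n) (x : ℝ) (hx : 0 < x) :
    (μ {X | x < reducedSum X n}).toReal =
      ∑ i ∈ Finset.range (n+1 - (⌊(n:ℝ)/2 + x * √n/2⌋₊ + 1)), bin n ((⌊(n:ℝ)/2 + x * √n/2⌋₊ + 1) + i) := by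
  classical
  have h := measure_coin μ hμ n (fun y => x < (y - n/2) / √((n:ℝ)/4))
  unfold reducedSum
  rw [h, ← Finset.sum_filter]
  rw [← Finset.sum_Ico_eq_sum_range]
  apply Finset.sum_congr _ (fun _ _ => rfl)
  ext k
  have hs : √((n:ℝ)/4) = √n/2 := by
    rw [Real.sqrt_div (by positivity), show (4:ℝ) = 2^2 by norm_num, Real.sqrt_sq (by norm_num)]
  have hs0 : 0 < √(n:ℝ) := by positivity
  simp only [Finset.mem_filter, Finset.mem_range, Finset.mem_Ico, Nat.succ_le_iff]
  rw [Nat.floor_lt (by positivity), hs, lt_div_iff₀ (by positivity), and_comm]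
  refine and_congr_left fun _ => ?_
  constructor <;> intro h <;> linarith

lemma bin_nonneg (n k : ℕ) : 0 ≤ bin n k := by unfold bin; positivity

lemma bin_succ (n k : ℕ) (h : k ≤ n) : bin n (k+1) * ((k:ℝ)+1) = bin n k * ((n:ℝ) - k) := by
  have := Nat.choose_succ_right_eq n k
  have h2 : ((n.choose (k+1) : ℝ)) * (k+1) = n.choose k * ((n:ℝ) - k) := by
    rw [← Nat.cast_sub h]; exact_mod_cast this
  unfold bin
  rw [div_mul_eq_mul_div, h2]; ring

lemma upper (n k N : ℕ) (hk : k ≤ n) (h2 : (n:ℝ) < 2 * k + 1) :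
    ∑ i ∈ Finset.range N, bin n (k+i) ≤ bin n k * (((k:ℝ)+1) / (2*k+1-n)) := by
  set r : ℝ := ((n:ℝ)-k)/(k+1) with hr
  have hkn : (k:ℝ) ≤ n := by exact_mod_cast hk
  have hr0 : 0 ≤ r := div_nonneg (by linarith) (by positivity)
  have hr1 : r < 1 := by rw [hr, div_lt_one (by positivity)]; linarith
  have key : ∀ i, bin n (k+i) ≤ bin n k * r^i := by
    intro i
    induction i with
    | zero => simp
    | succ i ih =>
      by_cases hi : k + i ≤ n
      · have h := bin_succ n (k+i) hi
        push_cast at h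
        have hin : (k:ℝ)+i ≤ n := by exact_mod_cast hi
        have : bin n (k+i+1) = bin n (k+i) * (((n:ℝ)-(k+i))/(k+i+1)) := by
          rw [mul_div_assoc', ← h]; field_simp
        rw [← add_assoc, this, pow_succ, ← mul_assoc]
        apply mul_le_mul ih _ (div_nonneg (by linarith) (by positivity)) (mul_nonneg (bin_nonneg _ _) (by positivity))
        rw [hr]
        have : (0:ℝ) ≤ i := by positivity
        apply div_le_div₀ <;> first | linarith | positivity
      · have : bin n (k+(i+1)) = 0 := by
          unfold bin; rw [Nat.choose_eq_zero_of_lt (by omega)]; simp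
        rw [this]; exact mul_nonneg (bin_nonneg _ _) (by positivity)
  calc _ ≤ ∑ i ∈ Finset.range N, bin n k * r^i := Finset.sum_le_sum fun i _ => key i
    _ = bin n k * ∑ i ∈ Finset.range N, r^i := by rw [Finset.mul_sum]
    _ ≤ bin n k * (1-r)⁻¹ := by
        apply mul_le_mul_of_nonneg_left _ (bin_nonneg _ _)
        rw [← tsum_geometric_of_lt_one hr0 hr1]
        exact (summable_geometric_of_lt_one hr0 hr1).sum_le_tsum _ (fun i _ => by positivity)
    _ = _ := by
        congr 1
        rw [hr, one_sub_div (by positivity), inv_div]; congr 1; ring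

lemma lower (n k m : ℕ) (hk : k + m ≤ n) (h2 : (n:ℝ) < 2 * k + 1) :
    bin n k * (((k:ℝ)+m+1) / (2*k+2*m+1-n) *
      (1 - Real.exp (-(m * ((2*k+2*m+1-n)/((k:ℝ)+m+1)))))) ≤ ∑ i ∈ Finset.range (n+1-k), bin n (k+i) := by
  set r : ℝ := ((n:ℝ)-k-m)/(k+m+1) with hr
  have hkn : (k:ℝ)+m ≤ n := by exact_mod_cast hk
  have hm0 : (0:ℝ) ≤ m := by positivity
  have hr0 : 0 ≤ r := div_nonneg (by linarith) (by positivity)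
  have h1r : 1 - r = (2*k+2*m+1-n)/((k:ℝ)+m+1) := by
    rw [hr, one_sub_div (by positivity)]; congr 1; ring
  have hpos : 0 < 1 - r := by rw [h1r]; exact div_pos (by linarith) (by positivity)
  have key : ∀ i, i ≤ m → bin n k * r^i ≤ bin n (k+i) := by
    intro i
    induction i with
    | zero => simp
    | succ i ih =>
      intro him
      have h := bin_succ n (k+i) (by omega)
      push_cast at h
      have hin : (i:ℝ) ≤ m := by exact_mod_cast (by omega : i ≤ m)
      have : bin n (k+i+1) = bin n (k+i) * (((n:ℝ)-(k+i))/(k+i+1)) := by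
        rw [mul_div_assoc', ← h]; field_simp
      rw [← add_assoc, this, pow_succ, ← mul_assoc]
      apply mul_le_mul (ih (by omega)) _ hr0 (bin_nonneg _ _)
      rw [hr]
      apply div_le_div₀ <;> first | linarith | positivity
  have hexp : r^m ≤ Real.exp (-(m * (1-r))) := by
    have : r ≤ Real.exp (-(1-r)) := by have := Real.add_one_le_exp (-(1-r)); linarith
    calc r^m ≤ (Real.exp (-(1-r)))^m := pow_le_pow_left₀ hr0 this m
      _ = _ := by rw [← Real.exp_nat_mul]; congr 1; ring
  rw [← h1r, ← inv_div, ← h1r]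
  calc bin n k * ((1-r)⁻¹ * (1 - Real.exp (-(m * (1-r))))) ≤ bin n k * ((1-r)⁻¹ * (1 - r^m)) := by
        apply mul_le_mul_of_nonneg_left _ (bin_nonneg _ _)
        apply mul_le_mul_of_nonneg_left _ (by positivity)
        linarith
    _ = bin n k * ∑ i ∈ Finset.range m, r^i := by
        rw [geom_sum_eq (by linarith), ← neg_div_neg_eq, neg_sub, neg_sub]; congr 1; rw [div_eq_inv_mul]
    _ = ∑ i ∈ Finset.range m, bin n k * r^i := by rw [Finset.mul_sum]
    _ ≤ ∑ i ∈ Finset.range m, bin n (k+i) := Finset.sum_le_sum fun i hi => key i (Finset.mem_range.mp hi).le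
    _ ≤ _ := by
        apply Finset.sum_le_sum_of_subset_of_nonneg
        · apply Finset.range_mono; omega
        · intros; exact bin_nonneg _ _

noncomputable def ent (t : ℝ) : ℝ := (1+t) * Real.log (1+t) + (1-t) * Real.log (1-t)

lemma ent_bound (t : ℝ) (ht : |t| ≤ 1/2) : |ent t - t^2| ≤ 5 * t^4 := by
  have h1 := Real.abs_log_sub_add_sum_range_le (x := t) (by linarith) 3
  have h2 := Real.abs_log_sub_add_sum_range_le (x := -t) (by rw [abs_neg]; linarith) 3
  simp only [Finset.sum_range_succ, Finset.sum_range_zero, abs_neg, sub_neg_eq_add] at h1 h2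
  norm_num at h1 h2
  have hb : |t|^4/(1-|t|) ≤ 2 * t^4 := by
    rw [div_le_iff₀ (by linarith)]
    have : |t|^4 = t^4 := by rw [show 4 = 2*2 by norm_num, pow_mul, sq_abs, ← pow_mul]
    rw [this]; have : 0 ≤ t^4 := by positivity
    nlinarith
  have h1' := abs_le.mp (h1.trans hb)
  have h2' := abs_le.mp (h2.trans hb)
  have ht' := abs_le.mp ht
  have h4 : 0 ≤ t^4 := by positivity
  unfold ent
  set a := Real.log (1+t)
  set b := Real.log (1-t)
  have e3 : (-t)^3 = -t^3 := by ring
  rw [e3] at h2'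
  rw [abs_le]
  constructor
  · nlinarith [mul_le_mul_of_nonneg_left h2'.1 (by linarith : 0 ≤ 1+t), mul_le_mul_of_nonneg_left h1'.1 (by linarith : 0 ≤ 1-t)]
  · nlinarith [mul_le_mul_of_nonneg_left h2'.2 (by linarith : 0 ≤ 1+t), mul_le_mul_of_nonneg_left h1'.2 (by linarith : 0 ≤ 1-t)]

lemma fact_eq (n : ℕ) (hn : 0 < n) :
    (n.factorial : ℝ) = Stirling.stirlingSeq n * √2 * √n * Real.exp (n * Real.log n - n) := by
  have hn' : (0:ℝ) < n := by exact_mod_cast hn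
  have : Real.exp (n * Real.log n - n) = (n/Real.exp 1)^n := by
    rw [div_pow, ← Real.exp_nat_mul, Real.exp_sub, mul_one, Real.exp_nat_mul, Real.exp_log hn']
  rw [this, Stirling.stirlingSeq, mul_assoc _ (√2), ← Real.sqrt_mul (by norm_num)]
  field_simp

lemma bin_eq (n k : ℕ) (hk : 0 < k) (hkn : k < n) (t : ℝ) (ht : t = (2*k-n)/n) :
    bin n k * √n = Stirling.stirlingSeq n / (Stirling.stirlingSeq k * Stirling.stirlingSeq (n-k))
      * (√2 / (√(1+t)*√(1-t))) * Real.exp (-(n/2 * ent t)) := by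
  have hn' : (0:ℝ) < n := by exact_mod_cast (by omega : 0 < n)
  have hk' : (0:ℝ) < k := by exact_mod_cast hk
  have hkn' : (k:ℝ) < n := by exact_mod_cast hkn
  have e1 : 1 + t = 2*k/n := by rw [ht]; field_simp; ring
  have e2 : 1 - t = 2*(n-k)/n := by rw [ht]; field_simp; ring
  unfold bin
  rw [Nat.cast_choose ℝ hkn.le, fact_eq n (by omega), fact_eq k hk, fact_eq (n-k) (by omega)]
  have s1 : 0 < Stirling.stirlingSeq k := by
    obtain ⟨j, rfl⟩ := Nat.exists_eq_succ_of_ne_zero hk.ne'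
    exact Stirling.stirlingSeq'_pos j
  have s2 : 0 < Stirling.stirlingSeq (n-k) := by
    obtain ⟨j, hj⟩ := Nat.exists_eq_succ_of_ne_zero (by omega : n-k ≠ 0)
    rw [hj]; exact Stirling.stirlingSeq'_pos j
  rw [Nat.cast_sub hkn.le]
  have hd : (0:ℝ) < n - k := by linarith
  have hE : Real.exp (-(n/2 * ent t)) = Real.exp (n * Real.log n - n) /
      (Real.exp (k * Real.log k - k) * Real.exp ((n-k) * Real.log (n-k) - (n-k)) * 2^n) := by
    have h2 : (2:ℝ)^n = Real.exp (n * Real.log 2) := by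
      rw [Real.exp_nat_mul, Real.exp_log (by norm_num)]
    rw [h2, ← Real.exp_add, ← Real.exp_add, ← Real.exp_sub]
    congr 1
    unfold ent
    rw [e1, e2, Real.log_div (by positivity) (by positivity), Real.log_div (by positivity) (by positivity),
      Real.log_mul (by positivity) (by positivity), Real.log_mul (by positivity) (by positivity)]
    field_simp
    ring
  rw [hE, e1, e2, Real.sqrt_div (by positivity), Real.sqrt_div (by positivity),
    Real.sqrt_mul (by positivity), Real.sqrt_mul (by positivity)]
  have q1 : 0 < √(n:ℝ) := by positivity
  have q2 : 0 < √(k:ℝ) := by positivity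
  have q3 : 0 < √((n:ℝ)-k) := by positivity
  field_simp

open Topology

lemma core (n k : ℕ → ℕ) (x s d : ℕ → ℝ) (hs : ∀ j, s j = √(n j))
    (hn : Tendsto n atTop atTop) (hx0 : ∀ j, 0 < x j)
    (hx : Tendsto x atTop atTop)
    (hxs : Tendsto (fun j => x j ^ 3 / s j) atTop (𝓝 0))
    (hd : ∀ j, d j = k j - (n j : ℝ)/2)
    (hd1 : ∀ j, x j * s j / 2 ≤ d j) (hd2 : ∀ j, d j ≤ x j * s j / 2 + 1) :
    Tendsto (fun j => (∑ i ∈ Finset.range (n j + 1 - k j), bin (n j) (k j + i)) /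
      (Real.exp (-(x j)^2/2) / (√(2*Real.pi) * x j))) atTop (𝓝 1) := by
  have hsT : Tendsto s atTop atTop := by
    rw [funext hs]
    exact Real.tendsto_sqrt_atTop.comp (tendsto_natCast_atTop_atTop.comp hn)
  have hsp : ∀ᶠ j in atTop, 0 < s j := hsT.eventually_gt_atTop 0
  have hsn : ∀ j, (n j : ℝ) = s j ^ 2 := fun j => by rw [hs, Real.sq_sqrt (by positivity)]
  have hs0 : ∀ j, 0 ≤ s j := fun j => by rw [hs]; positivity
  have hsi : Tendsto (fun j => 1 / s j) atTop (𝓝 0) := by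
    simp only [one_div]; exact hsT.inv_tendsto_atTop
  have hxi : Tendsto (fun j => 1 / x j) atTop (𝓝 0) := by
    simp only [one_div]; exact hx.inv_tendsto_atTop
  have hu : Tendsto (fun j => x j / s j) atTop (𝓝 0) := by
    have h := (hxs.mul (hxi.mul hxi))
    simp only [mul_zero] at h
    refine h.congr' ?_
    filter_upwards [hsp] with j h1
    have := hx0 j
    field_simp
  have hxsi : Tendsto (fun j => 1 / x j * (1 / s j)) atTop (𝓝 0) := by simpa using hxi.mul hsi
  have hD : Tendsto (fun j => d j / (x j * s j)) atTop (𝓝 (1/2)) := by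
    have h2 : Tendsto (fun j => 1/2 + 1 / x j * (1 / s j)) atTop (𝓝 (1/2)) := by
      simpa using (tendsto_const_nhds (x := (1/2:ℝ))).add hxsi
    refine tendsto_of_tendsto_of_tendsto_of_le_of_le' tendsto_const_nhds h2 ?_ ?_
    · filter_upwards [hsp] with j h1
      have := hx0 j
      rw [le_div_iff₀ (by positivity)]; linarith [hd1 j]
    · filter_upwards [hsp] with j h1
      have := hx0 j
      rw [div_le_iff₀ (by positivity)]
      have e : (1/2 + 1 / x j * (1 / s j)) * (x j * s j) = x j * s j / 2 + 1 := by field_simp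
      rw [e]; exact hd2 j
  -- t
  have htT : Tendsto (fun j => 2 * d j / s j^2) atTop (𝓝 0) := by
    have h := (hD.mul hu).const_mul 2
    simp only [mul_zero] at h
    refine h.congr' ?_
    filter_upwards [hsp] with j h1
    have := hx0 j
    field_simp
  have hs2 : Tendsto (fun j => s j^2) atTop atTop := (tendsto_pow_atTop two_ne_zero).comp hsT
  have hkT : Tendsto k atTop atTop := by
    rw [← tendsto_natCast_atTop_iff (R := ℝ)]
    refine tendsto_atTop_mono (f := fun j => s j^2/2) ?_ (hs2.atTop_div_const (by norm_num))
    intro j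
    have := hd j; have := hd1 j; have := hsn j
    have := mul_nonneg (hx0 j).le (hs0 j)
    linarith
  set m : ℕ → ℕ := fun j => ⌈s j⌉₊ with hm
  have hw : Tendsto (fun j => (m j : ℝ) / s j) atTop (𝓝 1) := (tendsto_nat_ceil_div_atTop).comp hsT
  have hnkm : Tendsto (fun j => (n j : ℝ) - k j - m j) atTop atTop := by
    have h : Tendsto (fun j => 1/2 - 2 * d j / s j^2 / 2 - (m j : ℝ)/s j * (1/s j)) atTop (𝓝 (1/2)) := by
      simpa using ((tendsto_const_nhds (x := (1/2:ℝ))).sub (htT.div_const 2)).sub (hw.mul hsi)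
    refine (hs2.atTop_mul_pos (by norm_num) h).congr' ?_
    filter_upwards [hsp] with j h1
    have := hd j; have := hsn j
    field_simp
    linarith
  have hkm : ∀ᶠ j in atTop, k j + m j < n j := by
    filter_upwards [hnkm.eventually_gt_atTop 0] with j h
    have : (k j : ℝ) + m j < n j := by linarith
    exact_mod_cast this
  have hnkT : Tendsto (fun j => n j - k j) atTop atTop := by
    rw [← tendsto_natCast_atTop_iff (R := ℝ)]
    refine tendsto_atTop_mono' _ ?_ hnkm
    filter_upwards [hkm] with j h
    rw [Nat.cast_sub (by omega)]
    have : (0:ℝ) ≤ m j := by positivity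
    linarith
  -- exponent
  have hE : Tendsto (fun j => -((n j : ℝ)/2 * ent (2 * d j / s j^2)) + x j^2/2) atTop (𝓝 0) := by
    have hA : Tendsto (fun j => (n j : ℝ)/2 * (ent (2 * d j / s j^2) - (2 * d j / s j^2)^2)) atTop (𝓝 0) := by
      have hB : Tendsto (fun j => 40 * (d j / (x j * s j))^4 * ((x j^3/s j) * (x j / s j))) atTop (𝓝 0) := by
        simpa using ((hD.pow 4).const_mul 40).mul (hxs.mul hu)
      refine squeeze_zero_norm' ?_ hB
      have : ∀ᶠ j in atTop, |2 * d j / s j^2| ≤ 1/2 := by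
        have h := htT.abs
        rw [abs_zero] at h
        exact h.eventually_le_const (by norm_num)
      filter_upwards [this, hsp] with j h1 h2
      have := hx0 j
      have hb := ent_bound _ h1
      rw [Real.norm_eq_abs, abs_mul, abs_of_nonneg (by positivity : (0:ℝ) ≤ (n j:ℝ)/2), hsn]
      calc _ ≤ s j^2/2 * (5 * (2 * d j / s j^2)^4) := by gcongr
        _ = _ := by field_simp; ring
    have hC : Tendsto (fun j => (n j : ℝ)/2 * (2 * d j / s j^2)^2 - x j^2/2) atTop (𝓝 0) := by
      have hB : Tendsto (fun j => 2 * (x j / s j) + 2 * (1 / s j * (1/s j))) atTop (𝓝 0) := by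
        simpa using (hu.const_mul 2).add ((hsi.mul hsi).const_mul 2)
      refine tendsto_of_tendsto_of_tendsto_of_le_of_le' tendsto_const_nhds hB ?_ ?_
      · filter_upwards [hsp] with j h2
        have := hx0 j
        have h1 : (x j * s j/2)^2 ≤ d j^2 := pow_le_pow_left₀ (by positivity) (hd1 j) 2
        have e : (n j : ℝ)/2 * (2 * d j / s j^2)^2 = 2 * d j^2 / s j^2 := by
          rw [hsn]; field_simp
        rw [e, sub_nonneg, le_div_iff₀ (by positivity)]
        linarith
      · filter_upwards [hsp] with j h2
        have := hx0 j
        have h0 : 0 ≤ d j := le_trans (by positivity) (hd1 j)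
        have h1 : d j^2 ≤ (x j * s j/2 + 1)^2 := pow_le_pow_left₀ h0 (hd2 j) 2
        have e : (n j : ℝ)/2 * (2 * d j / s j^2)^2 = 2 * d j^2 / s j^2 := by
          rw [hsn]; field_simp
        rw [e, sub_le_iff_le_add, div_le_iff₀ (by positivity)]
        have e2 : (2 * (x j / s j) + 2 * (1 / s j * (1/s j)) + x j^2/2) * s j^2 = 2 * (x j * s j/2 + 1)^2 := by
          field_simp; ring
        rw [e2]; linarith
    have := (hA.add hC).neg
    simp only [add_zero, neg_zero] at this
    refine this.congr fun j => ?_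
    ring
  have hB : Tendsto (fun j => bin (n j) (k j) * s j * Real.exp (x j^2/2)) atTop (𝓝 (√2/√Real.pi)) := by
    have hpi : √Real.pi ≠ 0 := by positivity
    have h1 := (Stirling.tendsto_stirlingSeq_sqrt_pi.comp hn).div
      ((Stirling.tendsto_stirlingSeq_sqrt_pi.comp hkT).mul (Stirling.tendsto_stirlingSeq_sqrt_pi.comp hnkT))
      (mul_ne_zero hpi hpi)
    have h2 : Tendsto (fun j => √2 / (√(1 + 2 * d j / s j^2) * √(1 - 2 * d j / s j^2))) atTop (𝓝 √2) := by
      have a1 := ((tendsto_const_nhds (x := (1:ℝ))).add htT).sqrt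
      have a2 := ((tendsto_const_nhds (x := (1:ℝ))).sub htT).sqrt
      have := (tendsto_const_nhds (x := √2)).div (a1.mul a2) (by simp)
      simp only [add_zero, sub_zero, Real.sqrt_one, mul_one, div_one] at this
      exact this
    have h3 := (Real.continuous_exp.tendsto 0).comp hE
    have h := (h1.mul h2).mul h3
    have e : √Real.pi / (√Real.pi * √Real.pi) * √2 * Real.exp 0 = √2/√Real.pi := by
      rw [Real.exp_zero]; field_simp
    rw [e] at h
    refine h.congr' ?_
    filter_upwards [hkm, hkT.eventually_gt_atTop 0, hsp] with j h1 h2 h3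
    have hb := bin_eq (n j) (k j) h2 (by omega) (2 * d j / s j^2) (by
      rw [hsn, hd, hsn]; field_simp)
    rw [hs, hb, ← hs]
    simp only [Function.comp_apply, Real.exp_add]
    simp only [Pi.div_apply, Function.comp_apply]
    ring
  have hG : ∀ v : ℕ → ℝ, Tendsto (fun j => v j / s j * (1 / s j)) atTop (𝓝 0) →
      Tendsto (fun j => 2 * (v j / s j) * (1 / x j)) atTop (𝓝 0) →
      Tendsto (fun j => ((k j : ℝ) + v j + 1) / (2 * k j + 2 * v j + 1 - n j) * (x j / s j)) atTop (𝓝 (1/2)) := by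
    intro v hv1 hv2
    have a1 := ((((tendsto_const_nhds (x := (1/2:ℝ))).add (htT.div_const 2)).add hv1).add (hsi.mul hsi))
    have a2 := ((hD.const_mul 2).add hv2).add hxsi
    have a3 := a1.div a2 (by norm_num)
    have e : (1/2 + 0/2 + 0 + 0*0) / (2 * (1/2) + 0 + 0) = (1/2:ℝ) := by norm_num
    rw [e] at a3
    refine a3.congr' ?_
    filter_upwards [hsp] with j h1
    have := hx0 j
    have e1 : (k j : ℝ) = d j + s j^2/2 := by rw [hd, hsn]; ring
    simp only [Pi.div_apply]
    have f1 : 1/2 + 2 * d j / s j^2/2 + v j / s j * (1/s j) + 1/s j * (1/s j) = (k j + v j + 1) / s j^2 := by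
      rw [e1]; field_simp; ring
    have f2 : 2 * (d j / (x j * s j)) + 2 * (v j / s j) * (1/x j) + 1/x j * (1/s j) =
        (2 * k j + 2 * v j + 1 - n j) / (x j * s j) := by
      rw [e1, hsn]; field_simp; ring
    rw [f1, f2, div_div_div_eq]
    rw [div_mul_div_comm]
    rw [show (k j + v j + 1) * (x j * s j) = s j * ((k j + v j + 1) * x j) by ring,
      show s j^2 * (2 * k j + 2 * v j + 1 - n j) = s j * ((2 * k j + 2 * v j + 1 - n j) * s j) by ring,
      mul_div_mul_left _ _ h1.ne']
  have hU := hG (fun _ => 0) (by simp) (by simp)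
  have hL := hG (fun j => m j) (by simpa using hw.mul hsi) (by simpa using (hw.const_mul 2).mul hxi)
  have hsq : √(2*Real.pi) * (√2/√Real.pi * (1/2)) = 1 := by
    rw [Real.sqrt_mul (by norm_num)]
    have : √Real.pi ≠ 0 := by positivity
    field_simp
    rw [Real.sq_sqrt (by norm_num)]
  have hUp := (hB.mul hU).const_mul (√(2*Real.pi))
  rw [hsq] at hUp
  have hX : Tendsto (fun j => Real.exp (-(m j * ((2*k j+2*m j+1-n j)/((k j:ℝ)+m j+1))))) atTop (𝓝 0) := by
    refine Real.tendsto_exp_neg_atTop_nhds_zero.comp ?_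
    have h := hx.atTop_mul_pos (by norm_num : (0:ℝ) < 1 / (1/2)) (hw.div hL (by norm_num))
    refine h.congr' ?_
    filter_upwards [hsp] with j h1
    have := hx0 j
    have h3 : (0:ℝ) < (k j:ℝ) + m j + 1 := by positivity
    have h4 : (0:ℝ) < 2*k j+2*m j+1-n j := by
      have := hd j; have := hd1 j
      have := mul_nonneg (hx0 j).le (hs0 j)
      have : (0:ℝ) ≤ m j := by positivity
      linarith
    simp only [Pi.div_apply]
    field_simp
  have hLo := (hB.mul (hL.mul ((tendsto_const_nhds (x := (1:ℝ))).sub hX))).const_mul (√(2*Real.pi))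
  rw [sub_zero, mul_one, hsq] at hLo
  refine tendsto_of_tendsto_of_tendsto_of_le_of_le' hLo hUp ?_ ?_
  · filter_upwards [hsp, hkm] with j h1 h2
    have hxj := hx0 j
    have h4 : (n j : ℝ) < 2*k j+1 := by
      have := hd j; have := hd1 j
      have := mul_nonneg (hx0 j).le (hs0 j)
      linarith
    have h := lower (n j) (k j) (m j) h2.le h4
    rw [le_div_iff₀ (by positivity)]
    refine le_trans (le_of_eq ?_) h
    rw [neg_div, Real.exp_neg (x j^2/2)]
    have := Real.exp_pos (x j^2/2)
    generalize Real.exp (x j^2/2) = E at *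
    generalize (1 - Real.exp (-((m j : ℝ) * ((2*k j+2*m j+1-n j)/((k j:ℝ)+m j+1))))) = F
    generalize ((k j:ℝ) + m j + 1) / (2*k j+2*m j+1-n j) = H
    field_simp
  · filter_upwards [hsp, hkm] with j h1 h2
    have hxj := hx0 j
    have h4 : (n j : ℝ) < 2*k j+1 := by
      have := hd j; have := hd1 j
      have := mul_nonneg (hx0 j).le (hs0 j)
      linarith
    have h := upper (n j) (k j) (n j + 1 - k j) (by omega) h4
    rw [div_le_iff₀ (by positivity)]
    refine le_trans h (le_of_eq ?_)
    rw [neg_div, Real.exp_neg]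
    have := Real.exp_pos (x j^2/2)
    have h5 : (2:ℝ) * k j + 1 - n j ≠ 0 := by linarith
    simp only [mul_zero, add_zero]
    field_simp

/-- Moderate deviation asymptotics: if `n_j → ∞`, `x_j > 0`, `x_j → ∞` and
`x_j³ / √(n_j) → 0`, then `μ {X | S*_{n_j}(X) > x_j} ∼ exp(−x_j²/2) / (√(2π) x_j)`,
i.e. the ratio of the two quantities tends to `1`. -/
theorem moderate_deviations (μ : Measure (ℕ → Bool)) (hμ : IsFairCoin μ)
    (nseq : ℕ → ℕ) (xseq : ℕ → ℝ)
    (hn : Tendsto nseq atTop atTop)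
    (hxpos : ∀ j, 0 < xseq j)
    (hx : Tendsto xseq atTop atTop)
    (hxn : Tendsto (fun j => xseq j ^ 3 / Real.sqrt (nseq j)) atTop (nhds 0)) :
    Tendsto
      (fun j => (μ {X | xseq j < reducedSum X (nseq j)}).toReal /
        (Real.exp (-(xseq j) ^ 2 / 2) / (Real.sqrt (2 * Real.pi) * xseq j)))
      atTop (nhds 1) := by
  have h := core nseq (fun j => ⌊(nseq j:ℝ)/2 + xseq j * √(nseq j)/2⌋₊ + 1) xseq
    (fun j => √(nseq j)) (fun j => ((⌊(nseq j:ℝ)/2 + xseq j * √(nseq j)/2⌋₊ + 1 : ℕ) : ℝ) - (nseq j : ℝ)/2)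
    (fun _ => rfl) hn hxpos hx hxn (fun _ => rfl)
    (fun j => by
      have := Nat.lt_floor_add_one ((nseq j:ℝ)/2 + xseq j * √(nseq j)/2)
      push_cast; linarith)
    (fun j => by
      have := hxpos j
      have := Nat.floor_le (a := (nseq j:ℝ)/2 + xseq j * √(nseq j)/2) (by positivity)
      push_cast; linarith)
  refine h.congr' ?_
  filter_upwards [hn.eventually_gt_atTop 0] with j hj
  rw [tail_coin μ hμ (nseq j) hj (xseq j) (hxpos j)]
end

section
/- Law of the Iterated Logarithm, standard form: for μ-almost every X ∈ 2^ℕ, limsup_{n→∞} (S_n(X) − n/2)/√((n/2)·log log n) = 1. -/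
open MeasureTheory Filter

open ProbabilityTheory

namespace LIL

structure Rad {Ω : Type*} [MeasurableSpace Ω] (μ : Measure Ω) (Y : ℕ → Ω → ℝ) : Prop where
  meas : ∀ i, Measurable (Y i)
  indep : iIndepFun Y μ
  bound : ∀ i ω, |Y i ω| ≤ 1
  mgf_eq : ∀ i t, mgf (Y i) μ t = Real.cosh t

variable {Ω : Type*} [MeasurableSpace Ω] {μ : Measure Ω} {Y : ℕ → Ω → ℝ}

lemma Rad.neg (h : Rad μ Y) : Rad μ (fun i ω => - Y i ω) where
  meas i := (h.meas i).neg
  indep := h.indep.comp (fun _ x => -x) (fun _ => measurable_neg)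
  bound i ω := by rw [abs_neg]; exact h.bound i ω
  mgf_eq i t := by
    have := h.mgf_eq i (-t)
    rw [Real.cosh_neg] at this
    rw [← this]
    simp [mgf]

lemma Rad.sum_abs (h : Rad μ Y) (s : Finset ℕ) (ω : Ω) : |∑ i ∈ s, Y i ω| ≤ s.card := by
  refine (Finset.abs_sum_le_sum_abs _ _).trans ?_
  refine (Finset.sum_le_sum fun i _ => h.bound i ω).trans ?_
  simp

lemma Rad.sum_meas (h : Rad μ Y) (s : Finset ℕ) : Measurable (fun ω => ∑ i ∈ s, Y i ω) :=
  Finset.measurable_sum _ fun i _ => h.meas i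

lemma Rad.integrable_exp (h : Rad μ Y) (t : ℝ) (s : Finset ℕ) :
    Integrable (fun ω => Real.exp (t * ∑ i ∈ s, Y i ω)) μ := by
  have : IsProbabilityMeasure μ := h.indep.isProbabilityMeasure
  refine Integrable.of_bound (C := Real.exp (|t| * s.card)) ?_ ?_
  · exact (Real.measurable_exp.comp ((h.sum_meas s).const_mul t)).aestronglyMeasurable
  · refine Eventually.of_forall fun ω => ?_
    rw [Real.norm_eq_abs, Real.abs_exp, Real.exp_le_exp]
    refine (le_abs_self _).trans ?_
    rw [abs_mul]
    exact mul_le_mul_of_nonneg_left (h.sum_abs s ω) (abs_nonneg _)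

lemma Rad.integral_exp (h : Rad μ Y) (t : ℝ) (s : Finset ℕ) :
    ∫ ω, Real.exp (t * ∑ i ∈ s, Y i ω) ∂μ = Real.cosh t ^ s.card := by
  have := h.indep.mgf_sum (t := t) h.meas s
  simp only [h.mgf_eq, Finset.prod_const] at this
  rw [← this]
  simp [mgf]

lemma Rad.submart (h : Rad μ Y) (t : ℝ) :
    Submartingale (fun n ω => Real.exp (t * ∑ i ∈ Finset.range (n+1), Y i ω))
      (Filtration.natural Y (fun i => (h.meas i).stronglyMeasurable)) μ := by
  have : IsProbabilityMeasure μ := h.indep.isProbabilityMeasure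
  have hsm : ∀ n, StronglyMeasurable[Filtration.natural Y (fun i => (h.meas i).stronglyMeasurable) n]
      (fun ω => Real.exp (t * ∑ i ∈ Finset.range (n+1), Y i ω)) := by
    intro n
    refine Measurable.stronglyMeasurable ?_
    refine Real.measurable_exp.comp (Measurable.const_mul ?_ t)
    refine Finset.measurable_sum _ fun i hi => ?_
    have hile : i ≤ n := by simpa [Nat.lt_succ_iff] using hi
    have := Filtration.stronglyAdapted_natural (fun i => (h.meas i).stronglyMeasurable) i
    exact this.measurable.mono ((Filtration.natural Y _).mono hile) le_rfl
  refine submartingale_nat hsm (fun n => h.integrable_exp t _) fun n => ?_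
  have hg1 : Integrable (fun ω => Real.exp (t * Y (n+1) ω)) μ := by
    simpa using h.integrable_exp t {n+1}
  have e1 : (fun ω => Real.exp (t * ∑ i ∈ Finset.range (n+1+1), Y i ω)) =
     (fun ω => Real.exp (t * ∑ i ∈ Finset.range (n+1), Y i ω)) *
      (fun ω => Real.exp (t * Y (n+1) ω)) := by
    ext ω
    rw [Finset.sum_range_succ, mul_add, Real.exp_add]; rfl
  have hint := h.integrable_exp t (Finset.range (n+1+1))
  rw [e1] at hint
  have e2 := condExp_mul_of_stronglyMeasurable_left (hsm n) hint hg1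
  have e3 : μ[(fun ω => Real.exp (t * Y (n+1) ω)) |
      Filtration.natural Y (fun i => (h.meas i).stronglyMeasurable) n] =ᵐ[μ]
      fun _ => Real.cosh t := by
    have hh := h.mgf_eq (n+1) t
    have := condExp_indep_eq (f := fun ω => Real.exp (t * Y (n+1) ω))
      (h.meas (n+1)).comap_le
      ((Filtration.natural Y (fun i => (h.meas i).stronglyMeasurable)).le n)
      (((Real.measurable_exp.comp (measurable_id.const_mul t)).comp
        (comap_measurable (Y (n+1)))).stronglyMeasurable)
      (h.indep.indep_comap_natural_of_lt (fun i => (h.meas i).stronglyMeasurable)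
        (Nat.lt_succ_self n))
    rw [← hh]
    exact this
  rw [e1]
  filter_upwards [e2, e3] with ω h2 h3
  rw [h2, Pi.mul_apply, h3]
  exact le_mul_of_one_le_right (Real.exp_pos _).le (Real.one_le_cosh t)

lemma Rad.maximal (h : Rad μ Y) (N : ℕ) (a v : ℝ) (ha : 0 < a) (hv : 0 < v) (hN : (N:ℝ) ≤ v) :
    μ {ω | ∃ n ≤ N, a ≤ ∑ i ∈ Finset.range n, Y i ω} ≤
      ENNReal.ofReal (Real.exp (-(a^2/(2*v)))) := by
  have : IsProbabilityMeasure μ := h.indep.isProbabilityMeasure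
  rcases N with _ | N
  · have : {ω | ∃ n ≤ 0, a ≤ ∑ i ∈ Finset.range n, Y i ω} = ∅ := by
      ext ω; simp [ha]
    rw [this]; simp
  set t := a / v with ht
  have htpos : 0 < t := by positivity
  have key := maximal_ineq (h.submart t) (fun n ω => (Real.exp_pos _).le)
    (ε := Real.toNNReal (Real.exp (t*a))) N
  set A := {ω | ((Real.toNNReal (Real.exp (t*a))) : ℝ) ≤
    (Finset.range (N+1)).sup' Finset.nonempty_range_add_one
      fun k => Real.exp (t * ∑ i ∈ Finset.range (k+1), Y i ω)} with hA
  have hsub : {ω | ∃ n ≤ N+1, a ≤ ∑ i ∈ Finset.range n, Y i ω} ⊆ A := by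
    rintro ω ⟨n, hn, hna⟩
    rcases n with _ | n
    · simp at hna; linarith
    · rw [hA, Set.mem_ofPred_eq, Finset.le_sup'_iff]
      refine ⟨n, by simp; omega, ?_⟩
      rw [Real.coe_toNNReal _ (Real.exp_pos _).le]
      exact Real.exp_le_exp.2 (mul_le_mul_of_nonneg_left hna htpos.le)
  refine (measure_mono hsub).trans ?_
  have h2 : ∫ ω in A, Real.exp (t * ∑ i ∈ Finset.range (N+1), Y i ω) ∂μ ≤ Real.exp (v*t^2/2) := by
    calc _ ≤ ∫ ω, Real.exp (t * ∑ i ∈ Finset.range (N+1), Y i ω) ∂μ :=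
          setIntegral_le_integral (h.integrable_exp t _) (Eventually.of_forall fun ω => (Real.exp_pos _).le)
      _ = Real.cosh t ^ (N+1) := by rw [h.integral_exp]; simp
      _ ≤ Real.exp (t^2/2) ^ (N+1) := by
          gcongr
          exact Real.cosh_le_exp_half_sq t
      _ = Real.exp (((N+1 : ℕ):ℝ) * (t^2/2)) := by rw [Real.exp_nat_mul]
      _ ≤ _ := by
          rw [Real.exp_le_exp, mul_div_assoc]
          exact mul_le_mul_of_nonneg_right hN (by positivity)
  have h3 := key.trans (ENNReal.ofReal_le_ofReal h2)
  have e0 : (Real.toNNReal (Real.exp (t*a)) : ENNReal) = ENNReal.ofReal (Real.exp (t*a)) := rfl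
  rw [e0, mul_comm, ← ENNReal.le_div_iff_mul_le (Or.inl (by simp [Real.exp_pos])) (Or.inl (by simp)),
    ← ENNReal.ofReal_div_of_pos (Real.exp_pos _), ← Real.exp_sub] at h3
  refine h3.trans (ENNReal.ofReal_le_ofReal (Real.exp_le_exp.2 (le_of_eq ?_)))
  rw [ht]; field_simp; ring

/-- Lower tail estimate. -/
lemma Rad.lower_tail (h : Rad μ Y) (s : Finset ℕ) (a δ : ℝ) (ha : 0 < a) (hδ : 0 < δ) (hδ1 : δ ≤ 1)
    (hs : 0 < s.card) (h1 : 6 * s.card ≤ a^2 * δ^2) (h2 : 4 * a^4 ≤ (s.card:ℝ)^3) :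
    Real.exp (-((1+2*δ)^2 * (a^2/(2*s.card)))) ≤ μ.real {ω | a ≤ ∑ i ∈ s, Y i ω} := by
  have : IsProbabilityMeasure μ := h.indep.isProbabilityMeasure
  have hn : (0:ℝ) < s.card := by exact_mod_cast hs
  set n : ℝ := (s.card : ℝ) with hnn
  set x := a^2/n with hx
  have hx0 : 0 < x := by positivity
  set t := (1+δ)*a/n with ht
  set b := (1+2*δ)*a with hb
  set S := fun ω => ∑ i ∈ s, Y i ω with hS
  have hupper : ∀ u : ℝ, ∫ ω, Real.exp (u * S ω) ∂μ ≤ Real.exp (n*(u^2/2)) := by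
    intro u
    rw [hS, h.integral_exp, hnn, Real.exp_nat_mul]
    gcongr
    exact Real.cosh_le_exp_half_sq u
  have hcosh : Real.exp (t^2/2 - t^4/4) ≤ Real.cosh t := by
    have hc : 1 + t^2/2 ≤ Real.cosh t := by
      have q1 : Real.cosh t = Real.cosh (t/2)^2 + Real.sinh (t/2)^2 := by
        rw [← Real.cosh_two_mul]; congr 1; ring
      have q2 := Real.cosh_sq (t/2)
      have q3 : |t/2| ≤ |Real.sinh (t/2)| := by
        rw [Real.abs_sinh]; exact Real.self_le_sinh_iff.2 (abs_nonneg _)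
      have q4 := sq_le_sq.2 q3
      nlinarith
    refine le_trans ?_ hc
    have hp : 0 < 1 + t^2/2 := by positivity
    rw [← Real.le_log_iff_exp_le hp]
    refine le_trans ?_ (Real.one_sub_inv_le_log_of_pos hp)
    have : 1 - (1+t^2/2)⁻¹ = t^2/2/(1+t^2/2) := by field_simp; ring
    rw [this, le_div_iff₀ hp]
    nlinarith [sq_nonneg (t^3)]
  have hlow : Real.exp (n*(t^2/2 - t^4/4)) ≤ ∫ ω, Real.exp (t * S ω) ∂μ := by
    rw [hS, h.integral_exp, hnn, Real.exp_nat_mul]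
    gcongr
  have hpt : ∀ ω, Real.exp (t * S ω) ≤
      {ω | a ≤ S ω}.indicator (fun _ => Real.exp (t*b)) ω
       + Real.exp (-(δ*a/n*b)) * Real.exp ((b/n) * S ω)
       + Real.exp ((δ*a/n*a)) * Real.exp ((a/n) * S ω) := by
    intro ω
    rw [← Real.exp_add, ← Real.exp_add]
    by_cases hc1 : S ω < a
    · have : Real.exp (t * S ω) ≤ Real.exp (δ*a/n*a + a/n * S ω) := by
        rw [Real.exp_le_exp]
        have : t = δ*a/n + a/n := by rw [ht]; ring
        rw [this, add_mul]
        gcongr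
      have h0 : 0 ≤ {ω | a ≤ S ω}.indicator (fun _ => Real.exp (t*b)) ω :=
        Set.indicator_nonneg (fun _ _ => (Real.exp_pos _).le) _
      have := Real.exp_pos (-(δ*a/n*b) + b/n * S ω)
      linarith
    · have hm : ω ∈ {ω | a ≤ S ω} := not_lt.1 hc1
      rw [Set.indicator_of_mem hm]
      by_cases hc2 : S ω ≤ b
      · have : Real.exp (t * S ω) ≤ Real.exp (t*b) := by
          rw [Real.exp_le_exp]; gcongr
        have := Real.exp_pos (-(δ*a/n*b) + b/n * S ω)
        have := Real.exp_pos (δ*a/n*a + a/n * S ω)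
        linarith
      · have : Real.exp (t * S ω) ≤ Real.exp (-(δ*a/n*b) + b/n * S ω) := by
          rw [Real.exp_le_exp]
          have e : b/n = t + δ*a/n := by rw [ht, hb]; ring
          rw [e, add_mul]
          have : δ*a/n*b ≤ δ*a/n * S ω := by
            have := (not_le.1 hc2).le
            gcongr
          linarith
        have := Real.exp_pos (t*b)
        have := Real.exp_pos (δ*a/n*a + a/n * S ω)
        linarith
  have hmeas : MeasurableSet {ω | a ≤ S ω} := measurableSet_le measurable_const (h.sum_meas s)
  have hi1 : Integrable ({ω | a ≤ S ω}.indicator (fun _ => Real.exp (t*b))) μ :=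
    (integrable_const _).indicator hmeas
  have hi2 := (h.integrable_exp (b/n) s).const_mul (Real.exp (-(δ*a/n*b)))
  have hi3 := (h.integrable_exp (a/n) s).const_mul (Real.exp (δ*a/n*a))
  have hI := integral_mono (h.integrable_exp t s) ((hi1.add hi2).add hi3) hpt
  have e1 := integral_add (hi1.add hi2) hi3
  have e2 := integral_add hi1 hi2
  have e3 : ∫ ω, {ω | a ≤ S ω}.indicator (fun _ => Real.exp (t*b)) ω ∂μ =
      μ.real {ω | a ≤ S ω} * Real.exp (t*b) := by
    rw [integral_indicator_const _ hmeas, smul_eq_mul]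
  have hI2 : Real.exp (n*(t^2/2 - t^4/4)) ≤ μ.real {ω | a ≤ S ω} * Real.exp (t*b)
      + Real.exp (-(δ*a/n*b)) * Real.exp (n*((b/n)^2/2))
      + Real.exp ((δ*a/n*a)) * Real.exp (n*((a/n)^2/2)) := by
    refine hlow.trans (hI.trans ?_)
    have e4 := e1.trans (congrArg₂ (· + ·) (e2.trans (congrArg₂ (· + ·) e3
      (integral_const_mul _ _))) (integral_const_mul _ _))
    refine e4.le.trans ?_
    exact add_le_add (add_le_add le_rfl (mul_le_mul_of_nonneg_left (hupper _) (Real.exp_pos _).le))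
      (mul_le_mul_of_nonneg_left (hupper _) (Real.exp_pos _).le)
  rw [← Real.exp_add, ← Real.exp_add] at hI2
  have f1 : -(δ*a/n*b) + n*((b/n)^2/2) = x*(1+2*δ)/2 := by
    rw [hx, hb]; field_simp; ring
  have f2 : δ*a/n*a + n*((a/n)^2/2) = x*(1+2*δ)/2 := by
    rw [hx]; field_simp; ring
  have f3 : x*(1+2*δ)/2 + 2 ≤ n*(t^2/2 - t^4/4) := by
    have g1 : n*(t^2/2) = x*(1+2*δ)/2 + x*δ^2/2 := by
      rw [hx, ht]; field_simp; ring
    have g2 : n*(t^4/4) ≤ 1 := by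
      have : n*(t^4/4) = (1+δ)^4 * a^4/(4*n^3) := by
        rw [ht]; field_simp
      rw [this, div_le_one (by positivity)]
      have : (1+δ)^4 ≤ (1+1)^4 := by gcongr
      have h4 : 0 < a^4 := by positivity
      nlinarith
    have g3 : 6 ≤ x*δ^2 := by
      rw [hx, div_mul_eq_mul_div, le_div_iff₀ hn]; exact h1
    linarith
  have f4 : 3 * Real.exp (x*(1+2*δ)/2) ≤ Real.exp (n*(t^2/2 - t^4/4)) := by
    refine le_trans ?_ (Real.exp_le_exp.2 f3)
    rw [Real.exp_add, mul_comm]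
    gcongr
    have := Real.add_one_le_exp (2:ℝ)
    linarith
  rw [f1, f2] at hI2
  have f5 : Real.exp (x*(1+2*δ)/2) ≤ μ.real {ω | a ≤ S ω} * Real.exp (t*b) := by linarith
  rw [← div_le_iff₀ (Real.exp_pos _), ← Real.exp_sub] at f5
  refine le_trans (Real.exp_le_exp.2 (le_of_eq ?_)) f5
  rw [hx, ht, hb]; field_simp; ring

lemma Rad.indep_blocks (h : Rad μ Y) (m : ℕ → ℕ) (hm : Monotone m) (a : ℕ → ℝ) :
    iIndepSet (fun k => {ω | a k ≤ ∑ i ∈ Finset.Ico (m k) (m (k+1)), Y i ω}) μ := by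
  have : IsProbabilityMeasure μ := h.indep.isProbabilityMeasure
  rw [iIndepSet_iff_meas_biInter
    (fun k => measurableSet_le measurable_const (h.sum_meas _))]
  have hle : ∀ i, MeasurableSpace.comap (Y i) inferInstance ≤ (inferInstance : MeasurableSpace Ω) :=
    fun i => (h.meas i).comap_le
  have hsum : ∀ (k : ℕ) (T : Set ℕ), (∀ i ∈ Finset.Ico (m k) (m (k+1)), i ∈ T) →
      MeasurableSet[⨆ i ∈ T, MeasurableSpace.comap (Y i) inferInstance]
        {ω | a k ≤ ∑ i ∈ Finset.Ico (m k) (m (k+1)), Y i ω} := by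
    intro k T hT
    have hfm : Measurable[⨆ i ∈ T, MeasurableSpace.comap (Y i) inferInstance]
        (fun ω => ∑ i ∈ Finset.Ico (m k) (m (k+1)), Y i ω) := ?_
    · exact hfm measurableSet_Ici
    refine Finset.measurable_sum _ fun i hi => ?_
    exact (comap_measurable (Y i)).mono
      (le_iSup₂_of_le (f := fun i (_ : i ∈ T) => MeasurableSpace.comap (Y i) inferInstance)
        i (hT i hi) le_rfl) le_rfl
  intro s
  induction s using Finset.induction_on_max with
  | empty => simp
  | insert j s hj ih =>
    rw [Finset.set_biInter_insert, Finset.prod_insert (fun hjs => lt_irrefl _ (hj j hjs)), ← ih]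
    have hd : Disjoint (Set.Ici (m j)) (Set.Iio (m j)) := by
      rw [Set.disjoint_left]; intro x hx hxb; exact absurd (Set.mem_Ici.1 hx) (not_le.2 (Set.mem_Iio.1 hxb))
    have hind := indep_iSup_of_disjoint hle h.indep.iIndep hd
    rw [Indep_iff] at hind
    refine hind _ _ (hsum j _ fun i hi => (Finset.mem_Ico.1 hi).1) ?_
    refine Finset.measurableSet_biInter _ fun k hk => hsum k _ fun i hi => ?_
    exact (Finset.mem_Ico.1 hi).2.trans_le (hm (hj k hk))


noncomputable def phi (n : ℕ) : ℝ := Real.sqrt (2 * n * Real.log (Real.log n))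

lemma Rad.upper (h : Rad μ Y) (q : ℝ) (hq : 1 < q) :
    ∀ᵐ ω ∂μ, ∀ᶠ n : ℕ in atTop, ∑ i ∈ Finset.range n, Y i ω ≤ q * phi n := by
  have hlq : 0 < Real.log q := Real.log_pos hq
  have hq0 : 0 < q := by linarith
  obtain ⟨k0, hk0⟩ := exists_nat_gt (1 / Real.log q)
  have hkge : ∀ k ≥ k0, 1 < (k:ℝ) * Real.log q := by
    intro k hk
    rw [div_lt_iff₀ hlq] at hk0
    have : (k0:ℝ) ≤ k := by exact_mod_cast hk
    nlinarith
  set a : ℕ → ℝ := fun k => Real.sqrt (2 * q * q^(k+1) * Real.log (k * Real.log q)) with ha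
  set B : ℕ → Set Ω := fun k => {ω | ∃ n ≤ ⌊q^(k+k0+1)⌋₊, a (k+k0) ≤ ∑ i ∈ Finset.range n, Y i ω}
    with hB
  have hBm : ∀ k, μ (B k) ≤
      ENNReal.ofReal ((Real.log q)^(-q) * ((k+k0 : ℕ):ℝ)^(-q)) := by
    intro k
    have hL : 0 < Real.log ((k+k0 : ℕ) * Real.log q) := Real.log_pos (hkge _ (by omega))
    have hv : 0 < q^(k+k0+1) := by positivity
    have h1 := h.maximal ⌊q^(k+k0+1)⌋₊ (a (k+k0)) (q^(k+k0+1)) (Real.sqrt_pos.2 (by positivity)) hv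
      (Nat.floor_le hv.le)
    refine h1.trans (ENNReal.ofReal_le_ofReal (le_of_eq ?_))
    have h2 : a (k+k0) ^ 2 = 2 * q * q^(k+k0+1) * Real.log ((k+k0 : ℕ) * Real.log q) :=
      Real.sq_sqrt (by positivity)
    have hkpos : 0 < ((k+k0 : ℕ) : ℝ) := by
      have := hkge (k+k0) (by omega)
      by_contra hc
      nlinarith [not_lt.1 hc]
    rw [h2, ← Real.mul_rpow hlq.le hkpos.le, mul_comm (Real.log q),
      Real.rpow_def_of_pos (by positivity)]
    congr 1
    field_simp
  have hsum : Summable fun k : ℕ => (Real.log q)^(-q) * ((k+k0 : ℕ):ℝ)^(-q) := by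
    refine Summable.mul_left _ ?_
    exact (summable_nat_add_iff (f := fun k : ℕ => (k:ℝ)^(-q)) k0).2
      (Real.summable_nat_rpow.2 (by linarith))
  have hne : ∑' k, μ (B k) ≠ ⊤ :=
    ne_top_of_le_ne_top hsum.tsum_ofReal_ne_top (ENNReal.tsum_le_tsum hBm)
  filter_upwards [ae_eventually_notMem hne] with ω hω
  obtain ⟨K, hK⟩ := eventually_atTop.1 hω
  obtain ⟨N, hN⟩ := exists_nat_ge (q^(K+k0))
  filter_upwards [eventually_ge_atTop N] with n hn
  have hnN : (N:ℝ) ≤ n := by exact_mod_cast hn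
  have hn1 : (1:ℝ) ≤ n := by
    have : 1 ≤ q^(K+k0) := one_le_pow₀ hq.le
    linarith
  obtain ⟨k, hk1, hk2⟩ := exists_nat_pow_near hn1 hq
  have hkK : K + k0 ≤ k := by
    have : q^(K+k0) < q^(k+1) := by linarith
    have := (pow_lt_pow_iff_right₀ hq).1 this
    omega
  have hb := hK (k-k0) (by omega)
  have e : k - k0 + k0 = k := by omega
  have hlt : ∑ i ∈ Finset.range n, Y i ω < a k := by
    by_contra hc
    apply hb
    refine ⟨n, ?_, ?_⟩
    · rw [e]; exact Nat.le_floor hk2.le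
    · rw [e]; exact not_lt.1 hc
  refine hlt.le.trans ?_
  have hgt := hkge k (by omega)
  have hll : Real.log (k * Real.log q) ≤ Real.log (Real.log n) := by
    refine Real.log_le_log (by linarith) ?_
    rw [← Real.log_pow]
    exact Real.log_le_log (by positivity) hk1
  have hlp : 0 < Real.log (k * Real.log q) := Real.log_pos hgt
  have : q * phi n = Real.sqrt (q^2 * (2 * n * Real.log (Real.log n))) := by
    rw [Real.sqrt_mul (by positivity), Real.sqrt_sq hq0.le]; rfl
  rw [this, ha]
  apply Real.sqrt_le_sqrt
  have e2 : 2 * q * q^(k+1) * Real.log (k * Real.log q) =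
    q^2 * (2 * q^k * Real.log (k * Real.log q)) := by ring
  rw [e2]
  gcongr

lemma Rad.lower (h : Rad μ Y) (M : ℕ) (hM : 2 ≤ M) :
    ∀ᵐ ω ∂μ, ∃ᶠ n : ℕ in atTop,
      ((1 - 1/(M:ℝ)) / (1 + 2 * (1/(M:ℝ))) - 2 * (1/(M:ℝ))) * phi n ≤
        ∑ i ∈ Finset.range n, Y i ω := by
  have : IsProbabilityMeasure μ := h.indep.isProbabilityMeasure
  have hMr : (2:ℝ) ≤ M := by exact_mod_cast hM
  set δ : ℝ := 1/(M:ℝ) with hδ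
  have hδ0 : 0 < δ := by positivity
  have hδ1 : δ ≤ 1/2 := by
    rw [hδ, div_le_div_iff₀ (by linarith) (by norm_num)]; linarith
  have hMδ : (M:ℝ) * δ = 1 := by rw [hδ]; field_simp
  -- eventual bounds
  have ev1 : ∀ᶠ x : ℝ in atTop, 32 * (Real.log (Real.log x))^2 ≤ x := by
    have o : (fun x : ℝ => Real.log x ^ (2:ℕ)) =o[atTop] (id : ℝ → ℝ) :=
      Real.isLittleO_pow_log_id_atTop
    have o2 := o.bound (show (0:ℝ) < 1/32 by norm_num)
    filter_upwards [o2, eventually_ge_atTop (Real.exp 1)] with x hx hx1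
    have l1 : 1 ≤ Real.log x := by
      rw [Real.le_log_iff_exp_le (lt_of_lt_of_le (Real.exp_pos _) hx1)]; exact hx1
    have l2 : Real.log (Real.log x) ≤ Real.log x := (Real.log_le_sub_one_of_pos (by linarith)).trans (by linarith)
    have l3 : 0 ≤ Real.log (Real.log x) := Real.log_nonneg l1
    have x0 : 0 < x := lt_of_lt_of_le (Real.exp_pos _) hx1
    rw [Real.norm_eq_abs, Real.norm_eq_abs, abs_of_nonneg (by positivity), id, abs_of_pos x0] at hx
    nlinarith
  have hll : Tendsto (fun x : ℝ => Real.log (Real.log x)) atTop atTop :=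
    Real.tendsto_log_atTop.comp Real.tendsto_log_atTop
  have ev2 := hll.eventually_ge_atTop (3 * (1+2*δ)^2 / δ^2)
  have hq1 : 1 < M^2 := by nlinarith
  have hqr : (1:ℝ) < ((M^2 : ℕ) : ℝ) := by exact_mod_cast hq1
  have htq : Tendsto (fun k : ℕ => (((M^2)^k : ℕ) : ℝ)) atTop atTop := by
    simp only [Nat.cast_pow (M^2)]
    exact tendsto_pow_atTop_atTop_of_one_lt hqr
  obtain ⟨k0, hk0⟩ := eventually_atTop.1 (htq.eventually (ev1.and ev2))
  set q := M^2 with hq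
  have hqM : (q:ℝ) = (M:ℝ)^2 := by rw [hq]; push_cast; ring
  have hlq : 0 < Real.log q := Real.log_pos hqr
  set m : ℕ → ℕ := fun k => q^(k+k0+1) with hm
  have hmono : Monotone m := by
    intro i j hij
    exact Nat.pow_le_pow_right (by omega) (by omega)
  set L : ℕ → ℝ := fun k => Real.log (Real.log (m (k+1) : ℕ)) with hL
  set c : ℕ → ℝ := fun k => ((Finset.Ico (m k) (m (k+1))).card : ℝ) with hc
  have hcard : ∀ k, c k = (m (k+1) : ℝ) * (1 - δ^2) := by
    intro k
    have h1 : (m (k+1) : ℝ) = (M:ℝ)^2 * m k := by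
      simp only [hm]; push_cast; rw [hqM]; ring
    simp only [hc, Nat.card_Ico, Nat.cast_sub (hmono (Nat.le_succ k))]
    rw [h1]
    have : (M:ℝ)^2 * δ^2 = 1 := by rw [← mul_pow, hMδ, one_pow]
    linear_combination (m k : ℝ) * this
  have hmpos : ∀ k, (0:ℝ) < m k := fun k => by
    have : 0 < m k := Nat.pow_pos (by omega)
    exact_mod_cast this
  have hcpos : ∀ k, 0 < c k := fun k => by
    rw [hcard]; have := hmpos (k+1); apply mul_pos this; nlinarith
  have hLge : ∀ k, 3 * (1+2*δ)^2 / δ^2 ≤ L k := fun k => (hk0 (k+1+k0+1) (by omega)).2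
  have hLsq : ∀ k, 32 * (L k)^2 ≤ m (k+1) := fun k => (hk0 (k+1+k0+1) (by omega)).1
  have hLpos : ∀ k, 0 < L k := fun k => lt_of_lt_of_le (by positivity) (hLge k)
  have hlogm : ∀ k, Real.log (m (k+1) : ℕ) = ((k+k0+2 : ℕ):ℝ) * Real.log q := by
    intro k
    simp only [hm, Nat.cast_pow q, Real.log_pow]
    congr 2; omega
  set a : ℕ → ℝ := fun k => Real.sqrt (2 * c k * L k) / (1+2*δ) with ha
  have hasq : ∀ k, a k ^2 * (1+2*δ)^2 = 2 * c k * L k := by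
    intro k
    have := hcpos k
    have := hLpos k
    simp only [ha]
    rw [div_pow, Real.sq_sqrt (by positivity)]
    field_simp
  have hprob : ∀ k, 1/(((k+k0+2 : ℕ):ℝ) * Real.log q) ≤
      (μ {ω | a k ≤ ∑ i ∈ Finset.Ico (m k) (m (k+1)), Y i ω}).toReal := by
    intro k
    have c0 := hcpos k
    have L0 := hLpos k
    have a0 : 0 < a k := div_pos (Real.sqrt_pos.2 (by positivity)) (by positivity)
    have hlt := h.lower_tail (Finset.Ico (m k) (m (k+1))) (a k) δ a0 hδ0 (by linarith)
      (Nat.cast_pos.1 c0) ?_ ?_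
    · refine le_trans (le_of_eq ?_) hlt
      change _ = Real.exp (-((1+2*δ)^2 * (a k ^2 / (2 * c k))))
      have : (1+2*δ)^2 * (a k ^2 / (2 * c k)) = L k := by
        rw [← mul_div_assoc, mul_comm, hasq]; field_simp
      rw [this, Real.exp_neg, hL]
      simp only
      rw [Real.exp_log, hlogm, one_div]
      rw [hlogm]; positivity
    · change 6 * c k ≤ a k ^2 * δ^2
      have h1 := hLge k
      rw [div_le_iff₀ (by positivity)] at h1
      have h2 : 6 * c k * (1+2*δ)^2 ≤ a k ^2 * δ^2 * (1+2*δ)^2 := by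
        have := hasq k
        calc 6 * c k * (1+2*δ)^2 = 2 * c k * (3 * (1+2*δ)^2) := by ring
          _ ≤ 2 * c k * (L k * δ^2) := by gcongr
          _ = a k ^2 * δ^2 * (1+2*δ)^2 := by linear_combination -(δ^2) * this
      exact le_of_mul_le_mul_right h2 (by positivity)
    · change 4 * a k ^4 ≤ c k ^3
      have h1 : a k ^2 ≤ 2 * c k * L k := by
        rw [← hasq]
        exact le_mul_of_one_le_right (by positivity) (by nlinarith)
      have h2 : 16 * (L k)^2 ≤ c k := by
        have := hLsq k
        rw [hcard]
        have := hmpos (k+1)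
        have hd : 1/2 ≤ 1 - δ^2 := by nlinarith
        have := mul_le_mul_of_nonneg_left hd this.le
        linarith
      calc 4 * a k ^4 = 4 * (a k ^2)^2 := by ring
        _ ≤ 4 * (2 * c k * L k)^2 := by gcongr
        _ = c k ^2 * (16 * (L k)^2) := by ring
        _ ≤ c k ^2 * c k := by gcongr
        _ = c k ^3 := by ring
  have hinf : ∑' k, μ {ω | a k ≤ ∑ i ∈ Finset.Ico (m k) (m (k+1)), Y i ω} = ⊤ := by
    by_contra hne
    have hs := ENNReal.summable_toReal hne
    have hs2 : Summable fun k : ℕ => 1/(((k+k0+2 : ℕ):ℝ) * Real.log q) :=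
      Summable.of_nonneg_of_le (fun k => by positivity) hprob hs
    have hs3 : Summable fun k : ℕ => 1/((k+(k0+2) : ℕ):ℝ) := by
      refine (hs2.mul_right (Real.log q)).congr fun k => ?_
      rw [← add_assoc]
      field_simp
    exact Real.not_summable_one_div_natCast
      ((summable_nat_add_iff (f := fun k : ℕ => 1/(k:ℝ)) (k0+2)).1 hs3)
  have hone := measure_limsup_eq_one
    (fun k => measurableSet_le measurable_const (h.sum_meas _)) (h.indep_blocks m hmono a) hinf
  have hmemlim : ∀ᵐ ω ∂μ, ω ∈ limsup (fun k => {ω | a k ≤ ∑ i ∈ Finset.Ico (m k) (m (k+1)), Y i ω})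
      atTop := by
    refine (mem_ae_iff_prob_eq_one ?_).2 hone
    exact MeasurableSet.measurableSet_limsup
      (fun k => measurableSet_le measurable_const (h.sum_meas _))
  have htm : Tendsto m atTop atTop := by
    have : Tendsto (fun k : ℕ => q^k) atTop atTop := tendsto_pow_atTop_atTop_of_one_lt hq1
    exact this.comp (tendsto_atTop_mono (fun k => by simp only [id]; omega) tendsto_id)
  filter_upwards [hmemlim, h.neg.upper 2 (by norm_num)] with ω h1 h2
  rw [mem_limsup_iff_frequently_mem] at h1
  have h3 := htm.eventually h2
  refine (htm.comp (tendsto_add_atTop_nat 1)).frequently ?_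
  refine (h1.and_eventually h3).mono ?_
  rintro k ⟨hk1, hk2⟩
  simp only [Function.comp]
  have hka : a k ≤ ∑ i ∈ Finset.Ico (m k) (m (k+1)), Y i ω := hk1
  rw [Finset.sum_neg_distrib] at hk2
  rw [← Finset.sum_range_add_sum_Ico _ (hmono (Nat.le_succ k))]
  have hphi0 : 0 ≤ phi (m (k+1)) := Real.sqrt_nonneg _
  have p1 : (1-δ) * phi (m (k+1)) / (1+2*δ) ≤ a k := by
    simp only [ha]
    gcongr
    have : (1-δ) * phi (m (k+1)) = Real.sqrt ((1-δ)^2 * (2 * m (k+1) * L k)) := by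
      rw [Real.sqrt_mul (by positivity), Real.sqrt_sq (by linarith)]; rfl
    rw [this]
    apply Real.sqrt_le_sqrt
    rw [hcard]
    have hp : 0 < (m (k+1) : ℝ) * L k := mul_pos (hmpos _) (hLpos _)
    have hd : (1-δ)^2 ≤ 1 - δ^2 := by nlinarith
    have := mul_le_mul_of_nonneg_right hd hp.le
    linarith
  have p2 : phi (m k) ≤ δ * phi (m (k+1)) := by
    have : δ * phi (m (k+1)) = Real.sqrt (δ^2 * (2 * m (k+1) * L k)) := by
      rw [Real.sqrt_mul (by positivity), Real.sqrt_sq (by linarith)]; rfl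
    rw [this, phi]
    apply Real.sqrt_le_sqrt
    have e1 : δ^2 * (2 * m (k+1) * L k) = 2 * m k * L k := by
      have h1 : (m (k+1) : ℝ) = (M:ℝ)^2 * m k := by
        simp only [hm]; push_cast; rw [hqM]; ring
      have : (M:ℝ)^2 * δ^2 = 1 := by rw [← mul_pow, hMδ, one_pow]
      rw [h1]
      linear_combination (2 * m k * L k) * this
    rw [e1]
    have := hmpos k
    gcongr
    simp only [hL]
    have h1m : (1:ℝ) < m k := by
      have : 1 < m k := Nat.one_lt_pow (by omega) hq1
      exact_mod_cast this
    refine Real.log_le_log (Real.log_pos h1m) (Real.log_le_log (by linarith) ?_)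
    exact_mod_cast hmono (Nat.le_succ k)
  have e : (1-δ) * phi (m (k+1)) / (1+2*δ) = (1-δ)/(1+2*δ) * phi (m (k+1)) := by ring
  rw [e] at p1
  linarith

lemma fair_rad (ν : Measure (ℕ → Bool)) (hν : IsFairCoin ν) :
    Rad ν (fun i X => 2 * ((X i).toNat : ℝ) - 1) := by
  obtain ⟨hp, hc⟩ := hν
  have hset : ∀ i, MeasurableSet {X : ℕ → Bool | X i = true} := fun i =>
    measurableSet_eq_fun (measurable_pi_apply i) measurable_const
  have hhalf : ∀ i, ν {X : ℕ → Bool | X i = true} = 1/2 := by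
    intro i
    simpa using hc {i} (fun _ => true)
  have hI : iIndepSet (fun i => {X : ℕ → Bool | X i = true}) ν := by
    rw [iIndepSet_iff_meas_biInter hset]
    intro s
    have := hc s (fun _ => true)
    simp only [hhalf, Finset.prod_const]
    rw [← this]
    congr 1
    ext X; simp
  have hY : (fun (i : ℕ) (X : ℕ → Bool) => 2 * ((X i).toNat : ℝ) - 1) =
      fun i => (fun x : ℝ => 2 * x - 1) ∘
        ({X : ℕ → Bool | X i = true}.indicator fun _ => (1:ℝ)) := by
    ext i X
    by_cases hX : X i = true <;> simp [Set.indicator, hX]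
  refine ⟨?_, ?_, ?_, ?_⟩
  · intro i
    rw [funext_iff] at hY
    rw [hY i]
    exact (measurable_id.const_mul 2 |>.sub_const 1).comp (measurable_const.indicator (hset i))
  · rw [hY]
    exact hI.iIndepFun_indicator.comp _ (fun _ => measurable_id.const_mul 2 |>.sub_const 1)
  · intro i X
    cases hX : X i <;> norm_num
  · intro i t
    have e : (fun X : ℕ → Bool => Real.exp (t * (2 * ((X i).toNat : ℝ) - 1))) =
      fun X => Real.exp (-t) +
        {X : ℕ → Bool | X i = true}.indicator (fun _ => Real.exp t - Real.exp (-t)) X := by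
      ext X
      by_cases hX : X i = true
      · simp [Set.indicator, hX]; norm_num
      · simp [Set.indicator, hX]
    rw [mgf, e, integral_add (integrable_const _) ((integrable_const _).indicator (hset i)),
      integral_indicator_const _ (hset i), Measure.real, hhalf, Real.cosh_eq]
    simp
    ring

end LIL

open LIL
/-- Law of the Iterated Logarithm, standard form: for `μ`-almost every `X`,
`limsup_n (S_n(X) − n/2) / √((n/2) log log n) = 1`. -/
theorem lil_standard (μ : Measure (ℕ → Bool)) (hμ : IsFairCoin μ) :
    ∀ᵐ X ∂μ,
      limsup (fun n : ℕ =>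
        (coinSum X n - n / 2) / Real.sqrt ((n / 2) * Real.log (Real.log n))) atTop = 1 := by
  have h := fair_rad μ hμ
  have hU : ∀ᵐ X ∂μ, ∀ j : ℕ, ∀ᶠ n : ℕ in atTop,
      ∑ i ∈ Finset.range n, (2 * ((X i).toNat : ℝ) - 1) ≤ (1 + 1/((j:ℝ)+1)) * phi n := by
    rw [ae_all_iff]
    intro j
    exact h.upper _ (by have : (0:ℝ) < 1/((j:ℝ)+1) := by positivity
                        linarith)
  have hL : ∀ᵐ X ∂μ, ∀ j : ℕ, ∃ᶠ n : ℕ in atTop,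
      ((1 - 1/((j+2 : ℕ):ℝ)) / (1 + 2 * (1/((j+2 : ℕ):ℝ))) - 2 * (1/((j+2 : ℕ):ℝ))) * phi n ≤
        ∑ i ∈ Finset.range n, (2 * ((X i).toNat : ℝ) - 1) := by
    rw [ae_all_iff]
    intro j
    exact h.lower (j+2) (by omega)
  have hphi : ∀ᶠ n : ℕ in atTop, 0 < phi n := by
    have hll : Tendsto (fun n : ℕ => Real.log (Real.log n)) atTop atTop :=
      Real.tendsto_log_atTop.comp (Real.tendsto_log_atTop.comp tendsto_natCast_atTop_atTop)
    filter_upwards [hll.eventually_gt_atTop 0, eventually_gt_atTop 0] with n h1 h2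
    have : (0:ℝ) < n := by exact_mod_cast h2
    exact Real.sqrt_pos.2 (by positivity)
  filter_upwards [hU, hL] with X hUX hLX
  have hfun : (fun n : ℕ => (coinSum X n - n / 2) / Real.sqrt ((n / 2) * Real.log (Real.log n))) =
      fun n : ℕ => (∑ i ∈ Finset.range n, (2 * ((X i).toNat : ℝ) - 1)) / phi n := by
    ext n
    have e1 : ∑ i ∈ Finset.range n, (2 * ((X i).toNat : ℝ) - 1) = 2 * (coinSum X n - n/2) := by
      rw [Finset.sum_sub_distrib, ← Finset.mul_sum, coinSum]
      simp
      ring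
    have e2 : phi n = 2 * Real.sqrt ((n / 2) * Real.log (Real.log n)) := by
      have : 2 * (n:ℝ) * Real.log (Real.log n) = 2^2 * ((n / 2) * Real.log (Real.log n)) := by ring
      rw [phi, this, Real.sqrt_mul (by positivity), Real.sqrt_sq (by norm_num)]
    rw [e1, e2, mul_div_mul_left _ _ (by norm_num : (2:ℝ) ≠ 0)]
  rw [hfun]
  set f := fun n : ℕ => (∑ i ∈ Finset.range n, (2 * ((X i).toNat : ℝ) - 1)) / phi n with hf
  have hle : ∀ j : ℕ, ∀ᶠ n in atTop, f n ≤ 1 + 1/((j:ℝ)+1) := by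
    intro j
    filter_upwards [hUX j, hphi] with n h1 h2
    rw [hf]; exact (div_le_iff₀ h2).2 h1
  have hge : ∀ j : ℕ, ∃ᶠ n in atTop,
      ((1 - 1/((j+2 : ℕ):ℝ)) / (1 + 2 * (1/((j+2 : ℕ):ℝ))) - 2 * (1/((j+2 : ℕ):ℝ))) ≤ f n := by
    intro j
    refine ((hLX j).and_eventually hphi).mono ?_
    rintro n ⟨h1, h2⟩
    rw [hf]; exact (le_div_iff₀ h2).2 h1
  have hbdd : IsBoundedUnder (· ≤ ·) atTop f := ⟨_, hle 0⟩
  have hcobdd : IsCoboundedUnder (· ≤ ·) atTop f := IsCoboundedUnder.of_frequently_ge (hge 0)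
  have hz : Tendsto (fun j : ℕ => 1/((j:ℝ)+1)) atTop (nhds 0) := tendsto_one_div_add_atTop_nhds_zero_nat
  have hz2 : Tendsto (fun j : ℕ => 1/((j+2 : ℕ):ℝ)) atTop (nhds 0) :=
    (tendsto_one_div_atTop_nhds_zero_nat (𝕜 := ℝ)).comp (tendsto_add_atTop_nat 2)
  apply le_antisymm
  · have hlim : Tendsto (fun j : ℕ => 1 + 1/((j:ℝ)+1)) atTop (nhds 1) := by
      simpa using hz.const_add 1
    exact ge_of_tendsto' hlim fun j => limsup_le_of_le hcobdd (hle j)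
  · have hlim : Tendsto (fun j : ℕ => (1 - 1/((j+2 : ℕ):ℝ)) / (1 + 2 * (1/((j+2 : ℕ):ℝ)))
        - 2 * (1/((j+2 : ℕ):ℝ))) atTop (nhds 1) := by
      have := ((hz2.const_sub 1).div ((hz2.const_mul 2).const_add 1) (by norm_num)).sub
        (hz2.const_mul 2)
      simpa using this
    exact le_of_tendsto' hlim fun j => le_limsup_of_frequently_le (hge j) hbdd
end

section
/- Two-sided Law of the Iterated Logarithm: for μ-almost every X ∈ 2^ℕ, liminf_{n→∞} (S_n(X) − n/2)/√((n/2)·log log n) = −1, and consequently limsup_{n→∞} |S_n(X) − n/2|/√((n/2)·log log n) = 1. -/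
open MeasureTheory Filter

/-- the event `E` depends only on the coordinates in `s` -/
def DepOn (s : Finset ℕ) (E : Set (ℕ → Bool)) : Prop :=
  ∀ X Y : ℕ → Bool, (∀ i ∈ s, X i = Y i) → X ∈ E → Y ∈ E

/-- the indicator point of a finite set -/
def indPt (t : Finset ℕ) : ℕ → Bool := fun i => decide (i ∈ t)

/-- cylinder -/
def cyl (s t : Finset ℕ) : Set (ℕ → Bool) := {X | ∀ i ∈ s, X i = indPt t i}

lemma measurableSet_cyl (s t : Finset ℕ) : MeasurableSet (cyl s t) := by
  have : cyl s t = ⋂ i ∈ s, (fun X : ℕ → Bool => X i) ⁻¹' {indPt t i} := by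
    ext X; simp [cyl]
  rw [this]
  exact Finset.measurableSet_biInter _ fun i _ => measurable_pi_apply i (measurableSet_singleton _)

open Classical in
lemma depOn_eq_biUnion {s : Finset ℕ} {E : Set (ℕ → Bool)} (h : DepOn s E) :
    E = ⋃ t ∈ s.powerset.filter (fun t => indPt t ∈ E), cyl s t := by
  ext X
  simp only [Finset.mem_filter, Finset.mem_powerset, Set.mem_iUnion, exists_prop]
  constructor
  · intro hX
    have hagree : ∀ i ∈ s, X i = indPt (s.filter (fun i => X i = true)) i := by
      intro i hi
      cases hXi : X i <;> simp [indPt, hi, hXi]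
    exact ⟨s.filter (fun i => X i = true), ⟨Finset.filter_subset _ _, h _ _ hagree hX⟩, hagree⟩
  · rintro ⟨t, ⟨_, htE⟩, hX⟩
    exact h _ _ (fun i hi => (hX i hi).symm) htE

open Classical in
lemma DepOn.measurableSet {s : Finset ℕ} {E : Set (ℕ → Bool)} (h : DepOn s E) :
    MeasurableSet E := by
  rw [depOn_eq_biUnion h]
  exact Finset.measurableSet_biUnion _ fun t _ => measurableSet_cyl s t

open Classical in
lemma DepOn.measure {μ : Measure (ℕ → Bool)} (hμ : IsFairCoin μ)
    {s : Finset ℕ} {E : Set (ℕ → Bool)} (h : DepOn s E) :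
    μ E = ((s.powerset.filter (fun t => indPt t ∈ E)).card : ENNReal) * (1 / 2) ^ s.card := by
  conv_lhs => rw [depOn_eq_biUnion h]
  rw [measure_biUnion_finset]
  · have hc : ∀ t, μ (cyl s t) = (1 / 2) ^ s.card := fun t => hμ.2 s (indPt t)
    simp only [hc, Finset.sum_const, nsmul_eq_mul]
  · intro t ht u hu htu
    rw [Function.onFun, Set.disjoint_left]
    intro X hX hX'
    apply htu
    simp only [Finset.coe_filter, Finset.mem_powerset, Set.mem_ofPred_eq] at ht hu
    ext i
    by_cases hi : i ∈ s
    · have := (hX i hi).symm.trans (hX' i hi)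
      simpa [indPt] using this
    · exact ⟨fun h => absurd (ht.1 h) hi, fun h => absurd (hu.1 h) hi⟩
  · exact fun t _ => measurableSet_cyl s t

lemma DepOn.mono {s u : Finset ℕ} {E : Set (ℕ → Bool)} (h : DepOn s E) (hsu : s ⊆ u) :
    DepOn u E := fun X Y hXY => h X Y fun i hi => hXY i (hsu hi)

lemma DepOn.inter {s u : Finset ℕ} {E F : Set (ℕ → Bool)} (hE : DepOn s E) (hF : DepOn u F) :
    DepOn (s ∪ u) (E ∩ F) := fun X Y hXY hX =>
  ⟨(hE.mono Finset.subset_union_left) X Y hXY hX.1,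
    (hF.mono Finset.subset_union_right) X Y hXY hX.2⟩

lemma DepOn.iff {s : Finset ℕ} {E : Set (ℕ → Bool)} (h : DepOn s E) {X Y : ℕ → Bool}
    (hXY : ∀ i ∈ s, X i = Y i) : X ∈ E ↔ Y ∈ E :=
  ⟨h X Y hXY, h Y X fun i hi => (hXY i hi).symm⟩

open Classical in
lemma DepOn.measure_inter {μ : Measure (ℕ → Bool)} (hμ : IsFairCoin μ)
    {s u : Finset ℕ} {E F : Set (ℕ → Bool)} (hE : DepOn s E) (hF : DepOn u F)
    (hsu : Disjoint s u) : μ (E ∩ F) = μ E * μ F := by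
  have hG := hE.inter hF
  generalize hGe : E ∩ F = G at hG ⊢
  rw [hG.measure hμ, hE.measure hμ, hF.measure hμ, Finset.card_union_of_disjoint hsu]
  have hd : ∀ i, i ∈ s → i ∈ u → False := fun i h1 h2 => Finset.disjoint_left.1 hsu h1 h2
  have : ((s ∪ u).powerset.filter (fun t => indPt t ∈ G)).card =
      ((s.powerset.filter (fun t => indPt t ∈ E)) ×ˢ
        (u.powerset.filter (fun t => indPt t ∈ F))).card := by
    subst hGe
    refine Finset.card_nbij' (fun t => (t ∩ s, t ∩ u)) (fun p => p.1 ∪ p.2) ?_ ?_ ?_ ?_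
    · intro t ht
      simp only [Finset.coe_filter, Finset.mem_powerset, Set.mem_ofPred_eq] at ht
      simp only [Finset.coe_product, Set.mem_prod, Finset.coe_filter, Finset.mem_powerset,
        Set.mem_ofPred_eq]
      refine ⟨⟨Finset.inter_subset_right, ?_⟩, ⟨Finset.inter_subset_right, ?_⟩⟩
      · exact (hE.iff (fun i hi => by simp [indPt, hi])).1 ht.2.1
      · exact (hF.iff (fun i hi => by simp [indPt, hi])).1 ht.2.2
    · intro p hp
      simp only [Finset.coe_product, Set.mem_prod, Finset.coe_filter, Finset.mem_powerset,
        Set.mem_ofPred_eq] at hp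
      simp only [Finset.coe_filter, Finset.mem_powerset, Set.mem_ofPred_eq]
      refine ⟨Finset.union_subset_union hp.1.1 hp.2.1, ?_, ?_⟩
      · refine (hE.iff (fun i hi => ?_)).1 hp.1.2
        have : i ∉ p.2 := fun h => hd i hi (hp.2.1 h)
        simp [indPt, this]
      · refine (hF.iff (fun i hi => ?_)).1 hp.2.2
        have : i ∉ p.1 := fun h => hd i (hp.1.1 h) hi
        simp [indPt, this]
    · intro t ht
      simp only [Finset.coe_filter, Finset.mem_powerset, Set.mem_ofPred_eq] at ht
      show t ∩ s ∪ t ∩ u = t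
      rw [← Finset.inter_union_distrib_left]
      exact Finset.inter_eq_left.2 ht.1
    · intro p hp
      simp only [Finset.coe_product, Set.mem_prod, Finset.coe_filter, Finset.mem_powerset,
        Set.mem_ofPred_eq] at hp
      have h1 := hp.1.1
      have h2 := hp.2.1
      ext i
      · simp only [Finset.mem_inter, Finset.mem_union]
        exact ⟨fun h => h.1.elim id fun h' => (hd i h.2 (h2 h')).elim, fun h => ⟨Or.inl h, h1 h⟩⟩
      · simp only [Finset.mem_inter, Finset.mem_union]
        exact ⟨fun h => h.1.elim (fun h' => (hd i (h1 h') h.2).elim) id, fun h => ⟨Or.inr h, h2 h⟩⟩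
  rw [this, Finset.card_product, pow_add]
  push_cast
  ring

lemma depOn_iIndepSet {μ : Measure (ℕ → Bool)} (hμ : IsFairCoin μ)
    {s : ℕ → Finset ℕ} {E : ℕ → Set (ℕ → Bool)} (hE : ∀ k, DepOn (s k) (E k))
    (hs : Pairwise (Function.onFun Disjoint s)) : ProbabilityTheory.iIndepSet E μ := by
  classical
  have := hμ.1
  rw [ProbabilityTheory.iIndepSet_iff_meas_biInter (fun k => (hE k).measurableSet)]
  intro S
  have key : DepOn (S.biUnion s) (⋂ i ∈ S, E i) ∧ μ (⋂ i ∈ S, E i) = ∏ i ∈ S, μ (E i) := by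
    induction S using Finset.induction_on with
    | empty => exact ⟨fun X Y _ h => by simp, by simp⟩
    | insert a S ha ih =>
      rw [Finset.set_biInter_insert, Finset.biUnion_insert, Finset.prod_insert ha]
      refine ⟨(hE a).inter ih.1, ?_⟩
      rw [(hE a).measure_inter hμ ih.1, ih.2]
      rw [Finset.disjoint_biUnion_right]
      intro i hi
      exact hs (fun h => ha (h ▸ hi))
  exact key.2

/-- count of ones in a block -/
def cnt (s : Finset ℕ) (X : ℕ → Bool) : ℕ := ∑ i ∈ s, (X i).toNat

lemma cnt_indPt {s t : Finset ℕ} (h : t ⊆ s) : cnt s (indPt t) = t.card := by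
  have : ∀ i, (indPt t i).toNat = if i ∈ t then 1 else 0 := by
    intro i; by_cases hi : i ∈ t <;> simp [indPt, hi]
  simp only [cnt, this]
  rw [← Finset.sum_filter, Finset.filter_mem_eq_inter, Finset.inter_eq_right.2 h]
  simp

lemma depOn_cnt (s : Finset ℕ) (p : ℕ → Prop) : DepOn s {X | p (cnt s X)} := by
  intro X Y h hX
  have : cnt s X = cnt s Y := Finset.sum_congr rfl fun i hi => by rw [h i hi]
  simpa [← this] using hX

lemma measure_cnt_le {μ : Measure (ℕ → Bool)} (hμ : IsFairCoin μ) (s : Finset ℕ) (r q : ℕ) :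
    ((∑ i ∈ Finset.Icc r q, s.card.choose i : ℕ) : ENNReal) * (1 / 2) ^ s.card
      ≤ μ {X | cnt s X ≤ q} := by
  classical
  rw [(depOn_cnt s (· ≤ q)).measure hμ]
  gcongr
  have : ∑ i ∈ Finset.Icc r q, s.card.choose i =
      ((Finset.Icc r q).biUnion (fun i => s.powersetCard i)).card := by
    rw [Finset.card_biUnion]
    · simp
    · intro i _ j _ hij
      exact Finset.pairwise_disjoint_powersetCard s hij
  rw [this]
  apply Finset.card_le_card
  intro t ht
  simp only [Finset.mem_biUnion, Finset.mem_powersetCard, Finset.mem_Icc] at ht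
  obtain ⟨i, hi, hts, htc⟩ := ht
  simp only [Finset.mem_filter, Finset.mem_powerset, Set.mem_ofPred_eq]
  refine ⟨hts, ?_⟩
  rw [cnt_indPt hts]; omega

/-! ### maximal inequality -/

lemma coinSum_congr {X Y : ℕ → Bool} {n : ℕ} (h : ∀ i ∈ Finset.range n, X i = Y i) :
    coinSum X n = coinSum Y n := Finset.sum_congr rfl fun i hi => by rw [h i hi]

lemma exp_pair (x : ℝ) : Real.exp (x / 2) + Real.exp (-(x / 2)) ≤ 2 * Real.exp (x ^ 2 / 8) := by
  have := Real.cosh_le_exp_half_sq (x / 2)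
  rw [Real.cosh_eq] at this
  have h2 : (x / 2) ^ 2 / 2 = x ^ 2 / 8 := by ring
  rw [h2] at this
  linarith

lemma maximal_aux {μ : Measure (ℕ → Bool)} (hμ : IsFairCoin μ) (σ a l : ℝ) (hσ : σ ^ 2 = 1)
    (hl : 0 ≤ l) (d : ℕ) : ∀ (n : ℕ) (f : ℕ → Bool),
    μ.real ({X | ∀ i ∈ Finset.range n, X i = f i} ∩
      {X | ∃ k, n ≤ k ∧ k ≤ n + d ∧ a ≤ σ * (coinSum X k - k / 2)}) ≤
      (1 / 2) ^ n * Real.exp (l * (σ * (coinSum f n - n / 2)) - l * a + l ^ 2 * d / 8) := by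
  have := hμ.1
  have hcyl : ∀ (n : ℕ) (f : ℕ → Bool), μ.real {X | ∀ i ∈ Finset.range n, X i = f i}
      = (1 / 2) ^ n := by
    intro n f
    rw [measureReal_def, hμ.2, Finset.card_range]
    simp
  have htriv : ∀ (d n : ℕ) (f : ℕ → Bool), a ≤ σ * (coinSum f n - n / 2) → μ.real ({X | ∀ i ∈ Finset.range n, X i = f i} ∩
      {X | ∃ k, n ≤ k ∧ k ≤ n + d ∧ a ≤ σ * (coinSum X k - k / 2)}) ≤
      (1 / 2) ^ n * Real.exp (l * (σ * (coinSum f n - n / 2)) - l * a + l ^ 2 * d / 8) := by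
    intro d n f h
    calc _ ≤ μ.real {X | ∀ i ∈ Finset.range n, X i = f i} :=
          measureReal_mono Set.inter_subset_left
      _ = (1 / 2) ^ n * 1 := by rw [hcyl, mul_one]
      _ ≤ _ := by
        gcongr
        apply Real.one_le_exp
        have := mul_le_mul_of_nonneg_left h hl
        have : 0 ≤ l ^ 2 * d / 8 := by positivity
        linarith
  induction d with
  | zero =>
    intro n f
    by_cases h : a ≤ σ * (coinSum f n - n / 2)
    · exact htriv 0 n f h
    · have : ({X | ∀ i ∈ Finset.range n, X i = f i} ∩
        {X | ∃ k, n ≤ k ∧ k ≤ n + 0 ∧ a ≤ σ * (coinSum X k - k / 2)}) = ∅ := by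
        ext X
        simp only [Set.mem_inter_iff, Set.mem_ofPred_eq, Set.mem_empty_iff_false, iff_false]
        rintro ⟨h1, k, hk1, hk2, h3⟩
        obtain rfl : k = n := by omega
        rw [coinSum_congr h1] at h3
        exact h h3
      rw [this, measureReal_empty]
      positivity
  | succ d ih =>
    intro n f
    by_cases h : a ≤ σ * (coinSum f n - n / 2)
    · exact htriv (d + 1) n f h
    · have hup : ∀ b, coinSum (Function.update f n b) (n + 1) = coinSum f n + (b.toNat : ℝ) := by
        intro b
        rw [coinSum, Finset.sum_range_succ, Function.update_self]
        congr 1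
        apply coinSum_congr
        intro i hi
        rw [Function.update_of_ne]
        exact (Finset.mem_range.1 hi).ne
      have hsub : ({X | ∀ i ∈ Finset.range n, X i = f i} ∩
        {X | ∃ k, n ≤ k ∧ k ≤ n + (d + 1) ∧ a ≤ σ * (coinSum X k - k / 2)}) ⊆
        ({X | ∀ i ∈ Finset.range (n + 1), X i = Function.update f n true i} ∩
        {X | ∃ k, n + 1 ≤ k ∧ k ≤ n + 1 + d ∧ a ≤ σ * (coinSum X k - k / 2)}) ∪
        ({X | ∀ i ∈ Finset.range (n + 1), X i = Function.update f n false i} ∩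
        {X | ∃ k, n + 1 ≤ k ∧ k ≤ n + 1 + d ∧ a ≤ σ * (coinSum X k - k / 2)}) := by
        rintro X ⟨h1, k, hk1, hk2, h3⟩
        simp only [Set.mem_ofPred_eq] at h1
        have hkn : k ≠ n := by
          rintro rfl
          rw [coinSum_congr h1] at h3
          exact h h3
        have hX : ∀ i ∈ Finset.range (n + 1), X i = Function.update f n (X n) i := by
          intro i hi
          by_cases hin : i = n
          · subst hin; simp
          · rw [Function.update_of_ne hin]
            apply h1
            simp only [Finset.mem_range] at hi ⊢
            omega
        have h2 : ∃ k, n + 1 ≤ k ∧ k ≤ n + 1 + d ∧ a ≤ σ * (coinSum X k - k / 2) :=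
          ⟨k, by omega, by omega, h3⟩
        cases hb : X n with
        | true => left; rw [hb] at hX; exact ⟨hX, h2⟩
        | false => right; rw [hb] at hX; exact ⟨hX, h2⟩
      refine (measureReal_mono hsub).trans ((measureReal_union_le _ _).trans ?_)
      refine (add_le_add (ih (n + 1) _) (ih (n + 1) _)).trans ?_
      rw [hup, hup]
      set B := l * (σ * (coinSum f n - n / 2)) - l * a + l ^ 2 * d / 8 with hB
      have e1 : l * (σ * (coinSum f n + ((true.toNat : ℕ) : ℝ) - ((n + 1 : ℕ) : ℝ) / 2)) - l * a
          + l ^ 2 * d / 8 = B + l * σ / 2 := by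
        rw [hB]; push_cast [Bool.toNat_true]; ring
      have e2 : l * (σ * (coinSum f n + ((false.toNat : ℕ) : ℝ) - ((n + 1 : ℕ) : ℝ) / 2)) - l * a
          + l ^ 2 * d / 8 = B + -(l * σ / 2) := by
        rw [hB]; push_cast [Bool.toNat_false]; ring
      have e3 : l * (σ * (coinSum f n - n / 2)) - l * a + l ^ 2 * ((d + 1 : ℕ) : ℝ) / 8
          = B + (l * σ) ^ 2 / 8 := by
        rw [hB, mul_pow, hσ]; push_cast; ring
      rw [e1, e2, e3, Real.exp_add B, Real.exp_add B, Real.exp_add B, pow_succ]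
      have := mul_le_mul_of_nonneg_left (exp_pair (l * σ))
        (show 0 ≤ (1 / 2 : ℝ) ^ n * Real.exp B by positivity)
      linarith

lemma maximal_real {μ : Measure (ℕ → Bool)} (hμ : IsFairCoin μ) (a : ℝ) (ha : 0 ≤ a) (N : ℕ)
    (M : ℝ) (hM : 0 < M) (hN : (N : ℝ) ≤ M) :
    μ.real {X | ∃ k, k ≤ N ∧ a ≤ |coinSum X k - k / 2|} ≤ 2 * Real.exp (-(2 * a ^ 2 / M)) := by
  have := hμ.1
  have key : ∀ σ : ℝ, σ ^ 2 = 1 →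
      μ.real {X | ∃ k, k ≤ N ∧ a ≤ σ * (coinSum X k - k / 2)} ≤ Real.exp (-(2 * a ^ 2 / M)) := by
    intro σ hσ
    have h := maximal_aux hμ σ a (4 * a / M) hσ (by positivity) N 0 (fun _ => true)
    simp only [Finset.range_zero, Finset.notMem_empty, false_imp_iff, implies_true,
      Set.ofPred_true, Set.univ_inter, zero_le, true_and, zero_add, pow_zero, one_mul] at h
    refine h.trans (Real.exp_le_exp.2 ?_)
    simp only [coinSum, Finset.range_zero, Finset.sum_empty]
    have : (4 * a / M) ^ 2 * N / 8 ≤ (4 * a / M) ^ 2 * M / 8 := by gcongr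
    have e : (4 * a / M) ^ 2 * M / 8 = 2 * a ^ 2 / M := by field_simp; ring
    have e2 : 4 * a / M * a = 2 * (2 * a ^ 2 / M) := by ring
    rw [e2]
    simp only [Nat.cast_zero, zero_div, sub_zero, mul_zero]
    linarith
  have hsub : {X | ∃ k, k ≤ N ∧ a ≤ |coinSum X k - k / 2|} ⊆
      {X | ∃ k, k ≤ N ∧ a ≤ 1 * (coinSum X k - k / 2)} ∪
      {X | ∃ k, k ≤ N ∧ a ≤ (-1) * (coinSum X k - k / 2)} := by
    rintro X ⟨k, hk, h⟩
    rcases le_abs.1 h with h | h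
    · left; exact ⟨k, hk, by linarith⟩
    · right; exact ⟨k, hk, by linarith⟩
  refine (measureReal_mono hsub).trans ((measureReal_union_le _ _).trans ?_)
  have h1 := key 1 (by norm_num)
  have h2 := key (-1) (by norm_num)
  linarith

/-! ### binomial estimate -/

lemma fact_aux (p i l : ℕ) :
    p.factorial * (p + i + l).factorial * p ^ l ≤
      (p + l).factorial * (p + i).factorial * (p + i) ^ l := by
  induction l with
  | zero => simp
  | succ l ih =>
    rw [← add_assoc, ← add_assoc, Nat.factorial_succ, Nat.factorial_succ (p + l), pow_succ,
      pow_succ]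
    have h : (p + i + l + 1) * p ≤ (p + l + 1) * (p + i) := by nlinarith [Nat.zero_le (i * l)]
    calc _ = (p.factorial * (p + i + l).factorial * p ^ l) * ((p + i + l + 1) * p) := by ring
      _ ≤ ((p + l).factorial * (p + i).factorial * (p + i) ^ l) * ((p + l + 1) * (p + i)) :=
        Nat.mul_le_mul ih h
      _ = _ := by ring

lemma choose_aux (p i : ℕ) :
    (p + i).centralBinom * p ^ i ≤ (2 * (p + i)).choose p * (p + i) ^ i := by
  have h1 : (2 * (p + i)).choose p * p.factorial * (p + i + i).factorial
      = (2 * (p + i)).factorial := by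
    have := Nat.choose_mul_factorial_mul_factorial (n := 2 * (p + i)) (k := p) (by omega)
    rwa [show 2 * (p + i) - p = p + i + i by omega] at this
  have h2 : (p + i).centralBinom * (p + i).factorial * (p + i).factorial
      = (2 * (p + i)).factorial := by
    have := Nat.choose_mul_factorial_mul_factorial (n := 2 * (p + i)) (k := p + i) (by omega)
    rwa [show 2 * (p + i) - (p + i) = p + i by omega] at this
  have h3 := fact_aux p i i
  have hpos : 0 < p.factorial * (p + i + i).factorial := by positivity
  refine Nat.le_of_mul_le_mul_right ?_ hpos
  calc (p + i).centralBinom * p ^ i * (p.factorial * (p + i + i).factorial)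
      = (p + i).centralBinom * (p.factorial * (p + i + i).factorial * p ^ i) := by ring
    _ ≤ (p + i).centralBinom * ((p + i).factorial * (p + i).factorial * (p + i) ^ i) := by gcongr
    _ = ((p + i).centralBinom * (p + i).factorial * (p + i).factorial) * (p + i) ^ i := by ring
    _ = ((2 * (p + i)).choose p * p.factorial * (p + i + i).factorial) * (p + i) ^ i := by
        rw [h1, h2]
    _ = _ := by ring

lemma central_aux (m : ℕ) (hm : 1 ≤ m) : 16 ^ m ≤ 4 * m * m.centralBinom ^ 2 := by
  induction m, hm using Nat.le_induction with
  | base => simp [Nat.centralBinom, Nat.choose]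
  | succ m hm ih =>
    have h := Nat.succ_mul_centralBinom_succ m
    refine Nat.le_of_mul_le_mul_left ?_ (show 0 < m + 1 by omega)
    calc (m + 1) * 16 ^ (m + 1) = 16 * (m + 1) * 16 ^ m := by ring
      _ ≤ 16 * (m + 1) * (4 * m * m.centralBinom ^ 2) := by gcongr
      _ = (64 * (m * (m + 1))) * m.centralBinom ^ 2 := by ring
      _ ≤ (16 * (2 * m + 1) ^ 2) * m.centralBinom ^ 2 := Nat.mul_le_mul_right _ (by nlinarith)
      _ = 4 * (2 * (2 * m + 1) * m.centralBinom) ^ 2 := by ring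
      _ = 4 * ((m + 1) * (m + 1).centralBinom) ^ 2 := by rw [h]
      _ = _ := by ring

lemma central_real (m : ℕ) (hm : 1 ≤ m) :
    (4 : ℝ) ^ m ≤ 2 * Real.sqrt m * m.centralBinom := by
  have h : (16 : ℝ) ^ m ≤ 4 * m * (m.centralBinom : ℝ) ^ 2 := by exact_mod_cast central_aux m hm
  apply le_of_sq_le_sq _ (by positivity)
  rw [mul_pow, mul_pow, Real.sq_sqrt (by positivity), ← pow_mul, mul_comm m 2, pow_mul]
  norm_num
  exact h

lemma choose_real (p i J m : ℕ) (hm : p + i = m) (hiJ : i ≤ J) (hJ : J < m) :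
    Real.exp (-((J : ℝ) ^ 2 / (m - J))) / (2 * Real.sqrt m) * 4 ^ m ≤ ((2 * m).choose p : ℝ) := by
  subst hm
  have hp : 0 < p := by omega
  have hpR : (0 : ℝ) < p := by exact_mod_cast hp
  have hc : ((p + i).centralBinom : ℝ) * p ^ i ≤ ((2 * (p + i)).choose p : ℝ) * (p + i) ^ i := by
    exact_mod_cast choose_aux p i
  have hce := central_real (p + i) (by omega)
  have hiR : (i : ℝ) ≤ J := by exact_mod_cast hiJ
  have hJR : (0 : ℝ) < ((p + i : ℕ) : ℝ) - J := by
    have : (J : ℝ) < ((p + i : ℕ) : ℝ) := by exact_mod_cast hJ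
    linarith
  have hexp : Real.exp (-((J : ℝ) ^ 2 / (((p + i : ℕ) : ℝ) - J))) * (p + i : ℝ) ^ i ≤ p ^ i := by
    have h1 : Real.exp (-((i : ℝ) / p)) * (p + i) ≤ p := by
      have := Real.add_one_le_exp ((i : ℝ) / p)
      rw [Real.exp_neg, inv_mul_le_iff₀ (Real.exp_pos _)]
      calc (p + i : ℝ) = ((i : ℝ) / p + 1) * p := by field_simp; ring
        _ ≤ _ := by gcongr
    have h2 : Real.exp (-((i : ℝ) ^ 2 / p)) * (p + i : ℝ) ^ i ≤ p ^ i := by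
      calc _ = (Real.exp (-((i : ℝ) / p)) * (p + i)) ^ i := by
            rw [mul_pow, ← Real.exp_nat_mul]; congr 2; ring
        _ ≤ _ := pow_le_pow_left₀ (by positivity) h1 i
    refine le_trans ?_ h2
    gcongr
    push_cast
    push_cast at hJR
    linarith
  have hsq : 0 < 2 * Real.sqrt ((p + i : ℕ) : ℝ) := by positivity
  have hpi : (0 : ℝ) < (p + i : ℝ) ^ i := by positivity
  set e := Real.exp (-((J : ℝ) ^ 2 / (((p + i : ℕ) : ℝ) - J)))
  rw [div_mul_eq_mul_div, div_le_iff₀ hsq]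
  refine le_of_mul_le_mul_right ?_ hpi
  have he : 0 ≤ e := (Real.exp_pos _).le
  calc e * 4 ^ (p + i) * (p + i : ℝ) ^ i = (e * (p + i : ℝ) ^ i) * 4 ^ (p + i) := by ring
    _ ≤ p ^ i * (2 * Real.sqrt ((p + i : ℕ) : ℝ) * (p + i).centralBinom) := by gcongr
    _ = (2 * Real.sqrt ((p + i : ℕ) : ℝ)) * ((p + i).centralBinom * p ^ i) := by ring
    _ ≤ (2 * Real.sqrt ((p + i : ℕ) : ℝ)) * (((2 * (p + i)).choose p : ℝ) * (p + i) ^ i) := by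
        gcongr
    _ = _ := by ring

lemma tail_lower {μ : Measure (ℕ → Bool)} (hμ : IsFairCoin μ) (s : Finset ℕ) (m J : ℕ)
    (hs : s.card = 2 * m) (hw : Nat.sqrt m ≤ J) (hJ : J < m) :
    ENNReal.ofReal (1 / 2 * Real.exp (-((J : ℝ) ^ 2 / (m - J)))) ≤
      μ {X | cnt s X ≤ m - J + Nat.sqrt m} := by
  refine le_trans ?_ (measure_cnt_le hμ s (m - J) (m - J + Nat.sqrt m))
  have hhalf : ((1 / 2 : ENNReal)) ^ s.card = ENNReal.ofReal ((1 / 2) ^ s.card) := by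
    rw [ENNReal.ofReal_pow (by norm_num)]
    congr 1
    rw [ENNReal.ofReal_div_of_pos (by norm_num)]; simp
  rw [hhalf, ← ENNReal.ofReal_natCast, ← ENNReal.ofReal_mul (by positivity)]
  apply ENNReal.ofReal_le_ofReal
  have hmpos : (0 : ℝ) < Real.sqrt m := Real.sqrt_pos.2 (by exact_mod_cast (by omega : 0 < m))
  set e := Real.exp (-((J : ℝ) ^ 2 / (m - J)))
  have hsum : ((Nat.sqrt m + 1 : ℕ) : ℝ) * (e / (2 * Real.sqrt m) * 4 ^ m) ≤
      ((∑ i ∈ Finset.Icc (m - J) (m - J + Nat.sqrt m), s.card.choose i : ℕ) : ℝ) := by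
    push_cast
    have hc : (Finset.Icc (m - J) (m - J + Nat.sqrt m)).card = Nat.sqrt m + 1 := by
      rw [Nat.card_Icc]; omega
    have := Finset.card_nsmul_le_sum (Finset.Icc (m - J) (m - J + Nat.sqrt m))
      (fun i => (s.card.choose i : ℝ)) (e / (2 * Real.sqrt m) * 4 ^ m) (by
        intro p hp
        rw [Finset.mem_Icc] at hp
        rw [hs]
        exact choose_real p (m - p) J m (by omega) (by omega) hJ)
    rw [hc, nsmul_eq_mul] at this
    exact_mod_cast this
  have hsqrt : Real.sqrt m ≤ ((Nat.sqrt m + 1 : ℕ) : ℝ) := by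
    push_cast
    exact Real.real_sqrt_le_nat_sqrt_succ
  have he : 0 < e := Real.exp_pos _
  have h4 : (4 : ℝ) ^ m * (1 / 2) ^ s.card = 1 := by
    rw [hs, pow_mul, ← mul_pow]; norm_num
  calc 1 / 2 * e = (Real.sqrt m * (e / (2 * Real.sqrt m) * 4 ^ m)) * (1 / 2) ^ s.card := by
        rw [mul_assoc, mul_assoc, h4]; field_simp
    _ ≤ _ := by
      gcongr
      refine le_trans ?_ hsum
      gcongr

/-! ### almost sure bounds -/

/-- the normalisation -/
noncomputable def phi (n : ℕ) : ℝ := Real.sqrt ((n / 2) * Real.log (Real.log n))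

lemma upper_ae {μ : Measure (ℕ → Bool)} (hμ : IsFairCoin μ) (ε : ℝ) (hε : 0 < ε) :
    ∀ᵐ X ∂μ, ∀ᶠ n : ℕ in atTop, |coinSum X n - n / 2| ≤ (1 + ε) * phi n := by
  have := hμ.1
  obtain ⟨c, hc⟩ : ∃ c, c = 1 + ε := ⟨_, rfl⟩
  rw [← hc]
  have hc1 : 1 < c := by linarith
  have hc0 : 0 < c := by linarith
  have hlc : 0 < Real.log c := Real.log_pos hc1
  set a : ℕ → ℝ := fun k => c * Real.sqrt (c ^ k / 2 * Real.log (k * Real.log c)) with ha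
  set A : ℕ → Set (ℕ → Bool) := fun k =>
    {X | ∃ j, j ≤ ⌊c ^ (k + 1)⌋₊ ∧ a k ≤ |coinSum X j - j / 2|} with hA
  have hev : ∀ᶠ k : ℕ in atTop, 1 ≤ (k : ℝ) * Real.log c := by
    have : Tendsto (fun k : ℕ => (k : ℝ) * Real.log c) atTop atTop :=
      tendsto_natCast_atTop_atTop.atTop_mul_const hlc
    exact this.eventually_ge_atTop 1
  have hbound : ∀ᶠ k : ℕ in atTop, ‖μ.real (A k)‖ ≤
      2 * Real.log c ^ (-c) * (k : ℝ) ^ (-c) := by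
    filter_upwards [hev, eventually_ge_atTop 1] with k hk hk1
    rw [Real.norm_of_nonneg measureReal_nonneg]
    refine (maximal_real hμ (a k) (by positivity) _ (c ^ (k + 1)) (by positivity)
      (Nat.floor_le (by positivity))).trans ?_
    have hlog : 0 ≤ Real.log (k * Real.log c) := Real.log_nonneg hk
    have hkpos : (0 : ℝ) < k := by exact_mod_cast hk1
    have e : 2 * a k ^ 2 / c ^ (k + 1) = c * Real.log (k * Real.log c) := by
      rw [ha]
      simp only
      rw [mul_pow, Real.sq_sqrt (by positivity)]
      field_simp
      ring
    rw [e, mul_assoc, ← Real.mul_rpow hlc.le hkpos.le, mul_comm (Real.log c),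
      Real.rpow_def_of_pos (by positivity)]
    apply le_of_eq
    congr 2
    ring
  have hsum : Summable (fun k => μ.real (A k)) := by
    refine Summable.of_norm_bounded_eventually_nat ?_ hbound
    exact (Real.summable_nat_rpow.2 (by linarith)).mul_left _
  have hfin : ∑' k, μ (A k) ≠ ⊤ := by
    have h := hsum.tsum_ofReal_ne_top
    simpa [measureReal_def, ENNReal.ofReal_toReal (measure_ne_top μ _)] using h
  filter_upwards [ae_eventually_notMem hfin] with X hX
  obtain ⟨K, hK⟩ := eventually_atTop.1 (hX.and hev)
  filter_upwards [eventually_ge_atTop (⌈c ^ K⌉₊), eventually_ge_atTop 1] with n hn hn1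
  have hnK : c ^ K ≤ (n : ℝ) := Nat.ceil_le.1 hn
  obtain ⟨k, hk1, hk2⟩ := exists_nat_pow_near (x := (n : ℝ)) (y := c) (by exact_mod_cast hn1) hc1
  have hkK : K ≤ k := by
    have : c ^ K < c ^ (k + 1) := hnK.trans_lt hk2
    have := (pow_lt_pow_iff_right₀ hc1).1 this
    omega
  obtain ⟨hXk, hk3⟩ := hK k hkK
  have hlt : |coinSum X n - n / 2| < a k := by
    by_contra hcon
    push Not at hcon
    exact hXk ⟨n, Nat.le_floor hk2.le, hcon⟩
  refine hlt.le.trans ?_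
  rw [ha]
  simp only [phi]
  have hlogn : (k : ℝ) * Real.log c ≤ Real.log n := by
    rw [← Real.log_pow]
    exact Real.log_le_log (by positivity) hk1
  have h0 : 0 ≤ Real.log (k * Real.log c) := Real.log_nonneg hk3
  have h1 : Real.log (k * Real.log c) ≤ Real.log (Real.log n) :=
    Real.log_le_log (by linarith) hlogn
  gcongr

set_option maxHeartbeats 1000000 in
lemma lower_asymp (ε : ℝ) (hε : 0 < ε) (hε1 : ε ≤ 1) (q : ℕ) (hq : 16 / ε ≤ q) :
    ∀ᶠ k : ℕ in atTop,
      1 ≤ k ∧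
      Real.sqrt (((q ^ 2 : ℕ) : ℝ) ^ (k + 1) * Real.log k) ≤
        ε / 4 * ((q ^ 2 : ℕ) : ℝ) ^ (k + 1) ∧
      (1 - ε) * phi (2 * (q ^ 2) ^ (k + 1)) + 2 * phi (2 * (q ^ 2) ^ k)
        + Real.sqrt (((q ^ 2) ^ k * (q ^ 2 - 1) : ℕ) : ℝ) + 1 ≤
        (1 - ε / 2) * Real.sqrt (((q ^ 2 : ℕ) : ℝ) ^ (k + 1) * Real.log k) := by
  have hq16 : (16 : ℝ) ≤ q := by
    refine le_trans ?_ hq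
    rw [le_div_iff₀ hε]; linarith
  have hqpos : (0 : ℝ) < q := by linarith
  have hqε : 16 ≤ ε * q := by
    have := (div_le_iff₀ hε).1 hq
    linarith
  obtain ⟨c, hc⟩ : ∃ c : ℕ, c = q ^ 2 := ⟨_, rfl⟩
  rw [← hc]
  have hcR : (c : ℝ) = (q : ℝ) ^ 2 := by rw [hc]; push_cast; ring
  have hc1 : (256 : ℝ) ≤ c := by rw [hcR]; nlinarith
  have hc0 : (0 : ℝ) < c := by linarith
  obtain ⟨η, hη⟩ : ∃ η, η = ε / 16 := ⟨_, rfl⟩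
  have hηpos : 0 < η := by rw [hη]; positivity
  have hlc : 0 < Real.log c := Real.log_pos (by linarith)
  have hl2c : 0 < Real.log (2 * c) := Real.log_pos (by linarith)
  obtain ⟨A, hA⟩ : ∃ A, A = Real.log (2 * c) + Real.log c := ⟨_, rfl⟩
  have hApos : 0 < A := by rw [hA]; positivity
  have hlogT : Tendsto (fun k : ℕ => Real.log (k : ℝ)) atTop atTop :=
    Real.tendsto_log_atTop.comp tendsto_natCast_atTop_atTop
  filter_upwards [eventually_ge_atTop 1, hlogT.eventually_ge_atTop (1 / η ^ 2),
    hlogT.eventually_ge_atTop (Real.log A / η), hlogT.eventually_ge_atTop 0] with k hk hk2 hk3 hk0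
  have hkR : (1 : ℝ) ≤ k := by exact_mod_cast hk
  set u := Real.sqrt ((c : ℝ) ^ (k + 1) * Real.log k) with hu
  have hu0 : 0 ≤ u := Real.sqrt_nonneg _
  have hP : (0 : ℝ) < (c : ℝ) ^ (k + 1) := by positivity
  have hpk : (1 : ℝ) ≤ (c : ℝ) ^ k := one_le_pow₀ (by linarith)
  refine ⟨hk, ?_, ?_⟩
  · rw [hu]
    apply Real.sqrt_le_iff.2
    refine ⟨by positivity, ?_⟩
    have h1 : Real.log k ≤ k := Real.log_le_self (by positivity)
    have h2 : (k : ℝ) ≤ (c : ℝ) ^ k := by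
      have : k < c ^ k := Nat.lt_pow_self (by
        have : (1 : ℝ) < c := by linarith
        exact_mod_cast this)
      exact_mod_cast this.le
    have h3 : (c : ℝ) ^ k ≤ ε ^ 2 / 16 * (c : ℝ) ^ (k + 1) := by
      rw [pow_succ (c : ℝ), hcR]
      have : 1 ≤ ε ^ 2 / 16 * (q : ℝ) ^ 2 := by nlinarith
      have := mul_le_mul_of_nonneg_left this (show 0 ≤ ((q : ℝ) ^ 2) ^ k by positivity)
      linarith
    have h4 : Real.log k ≤ ε ^ 2 / 16 * (c : ℝ) ^ (k + 1) := by linarith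
    have := mul_le_mul_of_nonneg_left h4 hP.le
    linarith
  · -- log log bound
    have hLL : Real.log (Real.log (2 * (c : ℝ) ^ (k + 1))) ≤ (1 + η) * Real.log k := by
      have e1 : Real.log (2 * (c : ℝ) ^ (k + 1)) ≤ A * k := by
        have : 2 * (c : ℝ) ^ (k + 1) = (2 * c) * (c : ℝ) ^ k := by ring
        rw [this, Real.log_mul (by positivity) (by positivity), Real.log_pow, hA]
        nlinarith
      have e0 : 0 < Real.log (2 * (c : ℝ) ^ (k + 1)) := by
        apply Real.log_pos
        have : (1 : ℝ) ≤ (c : ℝ) ^ (k + 1) := one_le_pow₀ (by linarith)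
        linarith
      refine (Real.log_le_log e0 e1).trans ?_
      rw [Real.log_mul hApos.ne' (by positivity)]
      have := (div_le_iff₀ hηpos).1 hk3
      linarith
    have hphi1 : phi (2 * c ^ (k + 1)) ≤ (1 + η) * u := by
      rw [phi]
      apply Real.sqrt_le_iff.2
      refine ⟨by positivity, ?_⟩
      rw [mul_pow, hu, Real.sq_sqrt (by positivity)]
      push_cast
      have e : 2 * (c : ℝ) ^ (k + 1) / 2 = (c : ℝ) ^ (k + 1) := by ring
      rw [e]
      calc (c : ℝ) ^ (k + 1) * Real.log (Real.log (2 * (c : ℝ) ^ (k + 1)))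
          ≤ (c : ℝ) ^ (k + 1) * ((1 + η) * Real.log k) := by gcongr
        _ ≤ (c : ℝ) ^ (k + 1) * ((1 + η) ^ 2 * Real.log k) := by gcongr; nlinarith
        _ = _ := by ring
    have hphi2 : phi (2 * c ^ k) ≤ (1 + η) * u / q := by
      rw [phi]
      apply Real.sqrt_le_iff.2
      refine ⟨by positivity, ?_⟩
      rw [div_pow, mul_pow, hu, Real.sq_sqrt (by positivity)]
      push_cast
      have e : 2 * (c : ℝ) ^ k / 2 = (c : ℝ) ^ k := by ring
      rw [e, ← hcR]
      have e0 : 0 < Real.log (2 * (c : ℝ) ^ k) := by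
        apply Real.log_pos
        linarith
      have hle : Real.log (Real.log (2 * (c : ℝ) ^ k)) ≤
          Real.log (Real.log (2 * (c : ℝ) ^ (k + 1))) := by
        apply Real.log_le_log e0
        apply Real.log_le_log (by positivity)
        gcongr
        · linarith
        · omega
      calc (c : ℝ) ^ k * Real.log (Real.log (2 * (c : ℝ) ^ k))
          ≤ (c : ℝ) ^ k * ((1 + η) * Real.log k) := by
            gcongr; exact hle.trans hLL
        _ ≤ (c : ℝ) ^ k * ((1 + η) ^ 2 * Real.log k) := by gcongr; nlinarith
        _ = _ := by field_simp; ring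
    have hsq : Real.sqrt ((c : ℝ) ^ (k + 1)) ≤ η * u := by
      apply Real.sqrt_le_iff.2
      refine ⟨by positivity, ?_⟩
      rw [mul_pow, hu, Real.sq_sqrt (by positivity)]
      have := (div_le_iff₀ (by positivity : 0 < η ^ 2)).1 hk2
      nlinarith
    have hone : 1 ≤ η * u := by
      refine le_trans ?_ hsq
      rw [Real.one_le_sqrt]
      exact one_le_pow₀ (by linarith)
    have hm : Real.sqrt ((c ^ k * (c - 1) : ℕ) : ℝ) ≤ η * u := by
      refine le_trans (Real.sqrt_le_sqrt ?_) hsq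
      have : c ^ k * (c - 1) ≤ c ^ (k + 1) := by
        rw [pow_succ]; exact Nat.mul_le_mul_left _ (by omega)
      exact_mod_cast this
    have hphi2' : phi (2 * c ^ k) ≤ ε / 8 * u := by
      refine hphi2.trans ?_
      rw [div_le_iff₀ hqpos]
      have : 1 + η ≤ ε / 8 * q := by rw [hη]; linarith
      have := mul_le_mul_of_nonneg_right this hu0
      linarith
    have h1 : (1 - ε) * phi (2 * c ^ (k + 1)) ≤ (1 - ε) * ((1 + η) * u) :=
      mul_le_mul_of_nonneg_left hphi1 (by linarith)
    have h2 : (1 - ε) * ((1 + η) * u) ≤ (1 - ε + η) * u := by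
      have : 0 ≤ ε * η * u := by positivity
      nlinarith
    have h3 : (1 - ε + η) * u + 2 * (ε / 8 * u) + η * u + η * u ≤ (1 - ε / 2) * u := by
      rw [hη]
      nlinarith [mul_nonneg hε.le hu0]
    linarith

lemma cnt_block (X : ℕ → Bool) {a b : ℕ} (h : a ≤ b) :
    (cnt (Finset.Ico a b) X : ℝ) = coinSum X b - coinSum X a := by
  rw [coinSum, coinSum, ← Finset.sum_range_add_sum_Ico _ h, cnt]
  push_cast
  ring

set_option maxHeartbeats 1000000 in
lemma lower_ae {μ : Measure (ℕ → Bool)} (hμ : IsFairCoin μ) (ε : ℝ) (hε : 0 < ε) (hε1 : ε ≤ 1) :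
    ∀ᵐ X ∂μ, ∃ᶠ n : ℕ in atTop, coinSum X n - n / 2 ≤ -((1 - ε) * phi n) := by
  have := hμ.1
  obtain ⟨q, hq⟩ := exists_nat_ge (16 / ε)
  have hasy := lower_asymp ε hε hε1 q hq
  have hq16 : (16 : ℝ) ≤ q := by
    refine le_trans ?_ hq
    rw [le_div_iff₀ hε]; linarith
  have hqε : 16 ≤ ε * q := by
    have := (div_le_iff₀ hε).1 hq
    linarith
  obtain ⟨c, hc⟩ : ∃ c : ℕ, c = q ^ 2 := ⟨_, rfl⟩
  rw [← hc] at hasy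
  have hcR : (c : ℝ) = (q : ℝ) ^ 2 := by rw [hc]; push_cast; ring
  have hc1 : (256 : ℝ) ≤ c := by rw [hcR]; nlinarith
  have hc256 : 256 ≤ c := by exact_mod_cast hc1
  set u : ℕ → ℝ := fun k => Real.sqrt ((c : ℝ) ^ (k + 1) * Real.log k) with hu
  set J : ℕ → ℕ := fun k => ⌊(1 - ε / 2) * u k⌋₊ with hJ
  set m : ℕ → ℕ := fun k => c ^ k * (c - 1) with hm
  set s : ℕ → Finset ℕ := fun k => Finset.Ico (2 * c ^ k) (2 * c ^ (k + 1)) with hs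
  set E : ℕ → Set (ℕ → Bool) := fun k => {X | cnt (s k) X ≤ m k - J k + Nat.sqrt (m k)} with hE
  have hmadd : ∀ k, 2 * c ^ (k + 1) = 2 * c ^ k + 2 * m k := by
    intro k
    obtain ⟨d, hd⟩ : ∃ d, c = d + 1 := ⟨c - 1, by omega⟩
    simp only [hm]
    rw [hd, Nat.add_sub_cancel]
    ring
  have hcard : ∀ k, (s k).card = 2 * m k := by
    intro k
    rw [hs]; simp only [Nat.card_Ico]
    rw [hmadd k]; omega
  have hmR : ∀ k, (m k : ℝ) = (c : ℝ) ^ (k + 1) - (c : ℝ) ^ k := by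
    intro k
    have h : ((2 * c ^ (k + 1) : ℕ) : ℝ) = ((2 * c ^ k + 2 * m k : ℕ) : ℝ) := by rw [hmadd k]
    push_cast at h
    linarith
  have hdep : ∀ k, DepOn (s k) (E k) := fun k => depOn_cnt (s k) (· ≤ m k - J k + Nat.sqrt (m k))
  have hdis : Pairwise (Function.onFun Disjoint s) := by
    have hlt : ∀ i j, i < j → Disjoint (s i) (s j) := by
      intro i j hij
      rw [Finset.disjoint_left]
      intro x hx hy
      simp only [hs, Finset.mem_Ico] at hx hy
      have : c ^ (i + 1) ≤ c ^ j := Nat.pow_le_pow_right (by omega) (by omega)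
      omega
    intro i j hij
    rcases lt_or_gt_of_ne hij with h | h
    · exact hlt i j h
    · exact (hlt j i h).symm
  have hind := depOn_iIndepSet hμ hdep hdis
  -- key numerical facts
  have hnum : ∀ᶠ k : ℕ in atTop, 1 ≤ k ∧ Nat.sqrt (m k) ≤ J k ∧ J k < m k ∧
      (J k : ℝ) ^ 2 / (m k - J k) ≤ Real.log k ∧
      (1 - ε) * phi (2 * c ^ (k + 1)) + 2 * phi (2 * c ^ k) + Real.sqrt (m k) ≤ J k := by
    filter_upwards [hasy] with k hk
    obtain ⟨hk1, hF1, hF2⟩ := hk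
    have hP : (0 : ℝ) < (c : ℝ) ^ (k + 1) := by positivity
    have hu0 : 0 ≤ u k := Real.sqrt_nonneg _
    have hlog : 0 ≤ Real.log (k : ℝ) := Real.log_nonneg (by exact_mod_cast hk1)
    have hJle : (J k : ℝ) ≤ (1 - ε / 2) * u k :=
      Nat.floor_le (mul_nonneg (by linarith) hu0)
    have hJge : (1 - ε / 2) * u k - 1 ≤ J k := (Nat.sub_one_lt_floor _).le
    have hp1 : 0 ≤ phi (2 * c ^ (k + 1)) := Real.sqrt_nonneg _
    have hp2 : 0 ≤ phi (2 * c ^ k) := Real.sqrt_nonneg _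
    have hp3 : 0 ≤ (1 - ε) * phi (2 * c ^ (k + 1)) := mul_nonneg (by linarith) hp1
    have hF2' : (1 - ε) * phi (2 * c ^ (k + 1)) + 2 * phi (2 * c ^ k) + Real.sqrt (m k) ≤ J k := by
      have : (1 - ε) * phi (2 * c ^ (k + 1)) + 2 * phi (2 * c ^ k) + Real.sqrt (m k) + 1
        ≤ (1 - ε / 2) * u k := hF2
      linarith
    have hcc : (c : ℝ) ^ k ≤ ε / 16 * (c : ℝ) ^ (k + 1) := by
      rw [pow_succ]
      have : 1 ≤ ε / 16 * c := by
        rw [hcR]; nlinarith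
      have := mul_le_mul_of_nonneg_left this (show 0 ≤ (c : ℝ) ^ k by positivity)
      linarith
    have hJu : (J k : ℝ) ≤ ε / 4 * (c : ℝ) ^ (k + 1) := by
      have : (1 - ε / 2) * u k ≤ u k := by nlinarith
      exact hJle.trans (this.trans hF1)
    have hmJ : (1 - ε / 2) ^ 2 * (c : ℝ) ^ (k + 1) ≤ m k - J k := by
      rw [hmR]
      have : (1 - ε / 2) ^ 2 ≤ 1 - 3 * ε / 4 := by nlinarith
      have := mul_le_mul_of_nonneg_right this hP.le
      nlinarith
    have hb : 0 < (1 - ε / 2) ^ 2 := by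
      have : 0 < 1 - ε / 2 := by linarith
      positivity
    have hmJpos : 0 < (m k : ℝ) - J k := lt_of_lt_of_le (by positivity) hmJ
    refine ⟨hk1, ?_, ?_, ?_, hF2'⟩
    · have h1 : (Nat.sqrt (m k) : ℝ) ≤ Real.sqrt (m k) := Real.nat_sqrt_le_real_sqrt
      have : (Nat.sqrt (m k) : ℝ) ≤ J k := by linarith
      exact_mod_cast this
    · have : (J k : ℝ) < m k := by linarith
      exact_mod_cast this
    · rw [div_le_iff₀ hmJpos]
      calc (J k : ℝ) ^ 2 ≤ ((1 - ε / 2) * u k) ^ 2 := by gcongr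
        _ = Real.log k * ((1 - ε / 2) ^ 2 * (c : ℝ) ^ (k + 1)) := by
          rw [mul_pow, hu]; simp only
          rw [Real.sq_sqrt (by positivity)]; ring
        _ ≤ _ := by gcongr
  have hdiv : ∑' k, μ (E k) = ⊤ := by
    by_contra hne
    have hsum : Summable (fun k => (μ (E k)).toReal) := ENNReal.summable_toReal hne
    have hlow : ∀ᶠ k : ℕ in atTop, ‖(1 / (k : ℝ))‖ ≤ 2 * (μ (E k)).toReal := by
      filter_upwards [hnum] with k hk
      obtain ⟨hk1, h1, h2, h3, _⟩ := hk
      have ht := tail_lower hμ (s k) (m k) (J k) (hcard k) h1 h2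
      have ht' := (ENNReal.ofReal_le_iff_le_toReal (measure_ne_top μ _)).1 ht
      have hkpos : (0 : ℝ) < k := by exact_mod_cast hk1
      have he : 1 / (k : ℝ) ≤ Real.exp (-((J k : ℝ) ^ 2 / (m k - J k))) := by
        have hinv : 1 / (k : ℝ) = Real.exp (-Real.log k) := by
          rw [Real.exp_neg, Real.exp_log hkpos, one_div]
        rw [hinv]
        exact Real.exp_le_exp.2 (by linarith)
      rw [Real.norm_of_nonneg (by positivity)]
      have : 1 / 2 * Real.exp (-((J k : ℝ) ^ 2 / (m k - J k))) ≤ (μ (E k)).toReal := ht'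
      linarith
    exact Real.not_summable_one_div_natCast
      (Summable.of_norm_bounded_eventually_nat (hsum.mul_left 2) hlow)
  have hlim := ProbabilityTheory.measure_limsup_eq_one (fun k => (hdep k).measurableSet) hind hdiv
  have hfreq : ∀ᵐ X ∂μ, X ∈ limsup E atTop :=
    (mem_ae_iff_prob_eq_one
      (MeasurableSet.measurableSet_limsup fun k => (hdep k).measurableSet)).2 hlim
  filter_upwards [hfreq, upper_ae hμ 1 one_pos] with X hX hup
  rw [mem_limsup_iff_frequently_mem] at hX
  have hT0 : Tendsto (fun k : ℕ => 2 * c ^ k) atTop atTop := by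
    refine tendsto_atTop_mono (fun k => ?_) tendsto_id
    have : k < c ^ k := Nat.lt_pow_self (by omega)
    simp only [id]; omega
  have hT1 : Tendsto (fun k : ℕ => 2 * c ^ (k + 1)) atTop atTop :=
    hT0.comp (tendsto_add_atTop_nat 1)
  refine hT1.frequently ?_
  refine (hX.and_eventually (hnum.and (hT0.eventually hup))).mono ?_
  rintro k ⟨hXE, ⟨hk1, h1, h2, h3, h4⟩, h5⟩
  have hcnt : (cnt (s k) X : ℝ) ≤ (m k - J k + Nat.sqrt (m k) : ℝ) := by
    have h : cnt (s k) X ≤ m k - J k + Nat.sqrt (m k) := hXE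
    have h' : (cnt (s k) X : ℝ) ≤ ((m k - J k + Nat.sqrt (m k) : ℕ) : ℝ) := by exact_mod_cast h
    rwa [Nat.cast_add, Nat.cast_sub h2.le] at h'
  rw [cnt_block X (by rw [hmadd k]; omega)] at hcnt
  have h6 : (Nat.sqrt (m k) : ℝ) ≤ Real.sqrt (m k) := Real.nat_sqrt_le_real_sqrt
  have h7 := (abs_le.1 h5).2
  have h8 : ((2 * c ^ (k + 1) : ℕ) : ℝ) = ((2 * c ^ k : ℕ) : ℝ) + 2 * m k := by
    rw [hmadd k]; push_cast; ring
  linarith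

/-- Two-sided Law of the Iterated Logarithm: for `μ`-almost every `X`,
`liminf_n (S_n(X) − n/2) / √((n/2) log log n) = −1` and
`limsup_n |S_n(X) − n/2| / √((n/2) log log n) = 1`. -/
theorem lil_two_sided (μ : Measure (ℕ → Bool)) (hμ : IsFairCoin μ) :
    ∀ᵐ X ∂μ,
      liminf (fun n : ℕ =>
          (coinSum X n - n / 2) / Real.sqrt ((n / 2) * Real.log (Real.log n))) atTop = -1 ∧
      limsup (fun n : ℕ =>
          |coinSum X n - n / 2| / Real.sqrt ((n / 2) * Real.log (Real.log n))) atTop = 1 := by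
  have hup : ∀ᵐ X ∂μ, ∀ p : ℕ, ∀ᶠ n : ℕ in atTop,
      |coinSum X n - n / 2| ≤ (1 + 1 / ((p : ℝ) + 1)) * phi n :=
    ae_all_iff.2 fun p => upper_ae hμ _ (by positivity)
  have hlo : ∀ᵐ X ∂μ, ∀ p : ℕ, ∃ᶠ n : ℕ in atTop,
      coinSum X n - n / 2 ≤ -((1 - 1 / ((p : ℝ) + 1)) * phi n) :=
    ae_all_iff.2 fun p => lower_ae hμ _ (by positivity) (by
      rw [div_le_one (by positivity)]
      have : (0 : ℝ) ≤ p := by positivity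
      linarith)
  filter_upwards [hup, hlo] with X h1 h2
  have hpos : ∀ᶠ n : ℕ in atTop, 0 < phi n := by
    have hlogT : Tendsto (fun k : ℕ => Real.log (Real.log (k : ℝ))) atTop atTop :=
      Real.tendsto_log_atTop.comp (Real.tendsto_log_atTop.comp tendsto_natCast_atTop_atTop)
    filter_upwards [hlogT.eventually_gt_atTop 0, eventually_ge_atTop 1] with n hn hn1
    have : (0 : ℝ) < n := by exact_mod_cast hn1
    exact Real.sqrt_pos.2 (by positivity)
  have hA : ∀ ε : ℝ, 0 < ε → ∀ᶠ n : ℕ in atTop, |coinSum X n - n / 2| / phi n ≤ 1 + ε := by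
    intro ε hε
    obtain ⟨p, hp⟩ := exists_nat_one_div_lt hε
    filter_upwards [h1 p, hpos] with n hn hn0
    rw [div_le_iff₀ hn0]
    refine hn.trans ?_
    gcongr
  have hB : ∀ ε : ℝ, 0 < ε → ∃ᶠ n : ℕ in atTop, (coinSum X n - n / 2) / phi n ≤ -1 + ε := by
    intro ε hε
    obtain ⟨p, hp⟩ := exists_nat_one_div_lt hε
    refine ((h2 p).and_eventually hpos).mono ?_
    rintro n ⟨hn, hn0⟩
    rw [div_le_iff₀ hn0]
    refine hn.trans ?_
    have := mul_lt_mul_of_pos_right hp hn0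
    linarith
  have hA' : ∀ ε : ℝ, 0 < ε → ∀ᶠ n : ℕ in atTop, -1 - ε ≤ (coinSum X n - n / 2) / phi n := by
    intro ε hε
    filter_upwards [hA ε hε, hpos] with n hn hn0
    rw [← abs_of_pos hn0, ← abs_div] at hn
    have := (abs_le.1 hn).1
    linarith
  have hB' : ∀ ε : ℝ, 0 < ε → ∃ᶠ n : ℕ in atTop, 1 - ε ≤ |coinSum X n - n / 2| / phi n := by
    intro ε hε
    refine ((hB ε hε).and_eventually hpos).mono ?_
    rintro n ⟨hn, hn0⟩
    rw [← abs_of_pos hn0, ← abs_div]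
    have := neg_abs_le ((coinSum X n - n / 2) / phi n)
    linarith
  constructor
  · change liminf (fun n : ℕ => (coinSum X n - n / 2) / phi n) atTop = -1
    apply le_antisymm
    · refine le_of_forall_pos_le_add fun ε hε => ?_
      exact liminf_le_of_frequently_le (hB ε hε) ⟨-1 - 1, eventually_map.2 (hA' 1 one_pos)⟩
    · refine le_of_forall_sub_le fun ε hε => ?_
      refine le_liminf_of_le ?_ (hA' ε hε)
      exact IsCoboundedUnder.of_frequently_le (hB 1 one_pos)
  · change limsup (fun n : ℕ => |coinSum X n - n / 2| / phi n) atTop = 1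
    apply le_antisymm
    · refine le_of_forall_pos_le_add fun ε hε => ?_
      refine limsup_le_of_le ?_ (hA ε hε)
      exact IsCoboundedUnder.of_frequently_ge (hB' 1 one_pos)
    · refine le_of_forall_sub_le fun ε hε => ?_
      exact le_limsup_of_frequently_le (hB' ε hε) ⟨1 + 1, eventually_map.2 (hA 1 one_pos)⟩
end

section
/- Lower half of the Law of the Iterated Logarithm: for μ-almost every X ∈ 2^ℕ, for every real λ < 1 there exist infinitely many n ∈ ℕ such that S_n(X) > n/2 + λ·√((n/2)·log log n). -/
open MeasureTheory Filter

lemma central_lower (M : ℕ) (hM : 1 ≤ M) : (16:ℝ)^M ≤ 4 * M * (M.centralBinom:ℝ)^2 := by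
  induction M, hM using Nat.le_induction with
  | base => norm_num [Nat.centralBinom, Nat.choose]
  | succ n hn ih =>
    have h := Nat.succ_mul_centralBinom_succ n
    have h' : ((n:ℝ)+1) * (Nat.centralBinom (n+1) : ℝ) = 2 * (2*n+1) * (Nat.centralBinom n : ℝ) := by
      exact_mod_cast h
    have hn0 : (0:ℝ) < (n:ℝ)+1 := by positivity
    have : ((n:ℝ)+1) * (16:ℝ)^(n+1) ≤ ((n:ℝ)+1) * (4 * ((n+1:ℕ):ℝ) * (Nat.centralBinom (n+1) : ℝ)^2) := by
      have e : ((n:ℝ)+1) * (4 * ((n+1:ℕ):ℝ) * (Nat.centralBinom (n+1) : ℝ)^2)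
          = 4 * (((n:ℝ)+1) * (Nat.centralBinom (n+1) : ℝ))^2 := by push_cast; ring
      rw [e, h', pow_succ]
      have h2 : ((n:ℝ)+1) * ((16:ℝ)^n * 16) ≤ ((n:ℝ)+1) * ((4 * n * (n.centralBinom:ℝ)^2) * 16) := by gcongr
      nlinarith [sq_nonneg (n.centralBinom:ℝ)]
    exact le_of_mul_le_mul_left this hn0

lemma central_lower' (M : ℕ) (hM : 1 ≤ M) : (4:ℝ)^M ≤ 2 * Real.sqrt M * (M.centralBinom:ℝ) := by
  refine (sq_le_sq₀ (by positivity) (by positivity)).mp ?_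
  have := central_lower M hM
  have e : ((4:ℝ)^M)^2 = 16^M := by rw [← pow_mul, mul_comm, pow_mul]; norm_num
  rw [e, mul_pow, mul_pow, Real.sq_sqrt (by positivity)]
  linarith

lemma choose_lower (M : ℕ) (D : ℝ) (hD : 0 < D) (i : ℕ) (hi : (i:ℝ) + D ≤ M) :
    (M.centralBinom:ℝ) * Real.exp (-(i:ℝ)^2 / D) ≤ ((2*M).choose (M+i) : ℝ) := by
  induction i with
  | zero => simp [Nat.centralBinom]
  | succ i ih =>
    push_cast at hi
    have ih := ih (by linarith)
    have hiM : i ≤ M := by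
      have : (i:ℝ) ≤ M := by linarith
      exact_mod_cast this
    have h := Nat.choose_succ_right_eq (2*M) (M+i)
    have h' : ((2*M).choose (M+i+1) : ℝ) * (M+i+1) = ((2*M).choose (M+i) : ℝ) * (M - i) := by
      have : 2*M - (M+i) = M - i := by omega
      rw [this] at h
      rw [← Nat.cast_sub hiM]
      exact_mod_cast h
    have hDi : D ≤ (M:ℝ) - i := by linarith
    have key : ((M:ℝ)+i+1) * Real.exp (-(2*i+1)/D) ≤ (M:ℝ)-i := by
      have h1 : (2*i+1)/((M:ℝ)-i) ≤ (2*i+1)/D := by gcongr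
      have h2 : (2*i+1)/D + 1 ≤ Real.exp ((2*i+1)/D) := Real.add_one_le_exp _
      have h3 : (M:ℝ)+i+1 ≤ ((M:ℝ)-i) * Real.exp ((2*i+1)/D) := by
        have h4 : (2*i+1)/((M:ℝ)-i) + 1 ≤ Real.exp ((2*i+1)/D) := by linarith
        have h5 : 0 < (M:ℝ)-i := by linarith
        calc (M:ℝ)+i+1 = ((M:ℝ)-i) * ((2*i+1)/((M:ℝ)-i) + 1) := by field_simp; ring
          _ ≤ _ := by gcongr
      rw [neg_div, Real.exp_neg]
      rw [← div_eq_mul_inv, div_le_iff₀ (Real.exp_pos _)]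
      exact h3
    have e : Real.exp (-((i+1:ℕ):ℝ)^2 / D) = Real.exp (-(i:ℝ)^2/D) * Real.exp (-(2*i+1)/D) := by
      rw [← Real.exp_add]; congr 1; push_cast; ring
    rw [e]
    have hp : (0:ℝ) < (M:ℝ)+i+1 := by positivity
    refine le_of_mul_le_mul_left ?_ hp
    rw [← add_assoc]
    calc _ = ((M.centralBinom:ℝ) * Real.exp (-(i:ℝ)^2 / D)) * (((M:ℝ)+i+1) * Real.exp (-(2*i+1)/D)) := by ring
      _ ≤ ((2*M).choose (M+i) : ℝ) * ((M:ℝ)-i) := by gcongr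
      _ = _ := by rw [← h']; ring

lemma sum_lower (M J : ℕ) (hM : 1 ≤ M) (hJ : (J:ℝ) + Real.sqrt M < M) :
    (1/2) * Real.exp (-((J:ℝ) + Real.sqrt M)^2 / (M - (J + Real.sqrt M))) ≤
      ∑ c ∈ Finset.Ico (M+J) (M+J+(Nat.sqrt M + 1)), ((2*M).choose c : ℝ) / 4^M := by
  set D : ℝ := M - (J + Real.sqrt M) with hDdef
  have hD : 0 < D := by linarith
  set E := Real.exp (-((J:ℝ) + Real.sqrt M)^2 / D)
  have hsq : (Nat.sqrt M : ℝ) ≤ Real.sqrt M := Real.nat_sqrt_le_real_sqrt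
  have hsq2 : Real.sqrt M ≤ (Nat.sqrt M : ℝ) + 1 := Real.real_sqrt_le_nat_sqrt_succ
  have h1 : ∀ c ∈ Finset.Ico (M+J) (M+J+(Nat.sqrt M + 1)), (M.centralBinom:ℝ) * E / 4^M ≤ ((2*M).choose c : ℝ) / 4^M := by
    intro c hc
    rw [Finset.mem_Ico] at hc
    obtain ⟨i, rfl⟩ : ∃ i, c = M + i := ⟨c - M, by omega⟩
    have hi : i ≤ J + Nat.sqrt M := by omega
    have hi' : (i:ℝ) ≤ J + Real.sqrt M := by
      have : (i:ℝ) ≤ J + Nat.sqrt M := by exact_mod_cast hi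
      linarith
    have := choose_lower M D hD i (by rw [hDdef]; linarith)
    have h2 : E ≤ Real.exp (-(i:ℝ)^2 / D) := by
      apply Real.exp_le_exp.mpr
      rw [neg_div, neg_div]
      apply neg_le_neg
      gcongr
    gcongr
    refine le_trans ?_ this
    gcongr
  have h2 := Finset.card_nsmul_le_sum _ _ _ h1
  refine le_trans ?_ h2
  rw [Nat.card_Ico, nsmul_eq_mul]
  have : M+J+(Nat.sqrt M + 1) - (M+J) = Nat.sqrt M + 1 := by omega
  rw [this]
  push_cast
  have h3 := central_lower' M hM
  have h4 : (4:ℝ)^M ≤ 2 * ((Nat.sqrt M:ℝ)+1) * M.centralBinom := by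
    refine h3.trans ?_
    gcongr
  have hE : 0 < E := Real.exp_pos _
  rw [← mul_div_assoc, le_div_iff₀ (by positivity)]
  nlinarith


open ProbabilityTheory in
lemma fair_iIndepFun (μ : Measure (ℕ → Bool)) (hμ : IsFairCoin μ) :
    iIndepFun (fun (i : ℕ) (X : ℕ → Bool) => X i) μ := by
  obtain ⟨hp, h⟩ := hμ
  have hm : ∀ i : ℕ, MeasurableSet {X : ℕ → Bool | X i = true} := fun i =>
    measurableSet_eq_fun (measurable_pi_apply i) measurable_const
  have h1 : iIndepSet (fun i : ℕ => {X : ℕ → Bool | X i = true}) μ := by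
    rw [iIndepSet_iff_meas_biInter hm]
    intro s
    have e : (⋂ i ∈ s, {X : ℕ → Bool | X i = true}) = {X | ∀ i ∈ s, X i = (fun _ => true) i} := by
      ext X; simp
    have e2 : ∀ i, μ {X : ℕ → Bool | X i = true} = 1/2 := by
      intro i
      have := h {i} (fun _ => true)
      simpa using this
    rw [e, h]
    simp [e2]
  rw [iIndepFun_iff_iIndep]
  rw [iIndepSet_iff_iIndep] at h1
  refine iIndep_of_iIndep_of_le h1 ?_
  intro i
  rw [← measurable_iff_comap_le]
  have : @MeasurableSet _ (MeasurableSpace.generateFrom {{X : ℕ → Bool | X i = true}}) {X : ℕ → Bool | X i = true} :=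
    MeasurableSpace.measurableSet_generateFrom rfl
  refine @measurable_to_bool _ (MeasurableSpace.generateFrom {{X : ℕ → Bool | X i = true}}) _ this

lemma blocks_iIndepSet (μ : Measure (ℕ → Bool)) (hμ : IsFairCoin μ) (B : ℕ → Finset ℕ)
    (hB : Pairwise (Function.onFun Disjoint B)) (A : ℕ → Set (ℕ → Bool))
    (hA : ∀ k, MeasurableSet[⨆ i ∈ (B k : Set ℕ), (⊤ : MeasurableSpace Bool).comap (fun X : ℕ → Bool => X i)] (A k)) :
    ProbabilityTheory.iIndepSet A μ := by
  have hind := (ProbabilityTheory.iIndepFun_iff_iIndep _ _ _).1 (fair_iIndepFun μ hμ)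
  have := hμ.1
  have hle : ∀ i : ℕ, (⊤ : MeasurableSpace Bool).comap (fun X : ℕ → Bool => X i) ≤ MeasurableSpace.pi := fun i =>
    (measurable_pi_apply i).comap_le
  have hAm : ∀ k, MeasurableSet (A k) := fun k => (iSup₂_le (fun i _ => hle i)) _ (hA k)
  rw [ProbabilityTheory.iIndepSet_iff_meas_biInter hAm]
  intro s
  induction s using Finset.induction_on with
  | empty => simp
  | insert a s ha ih =>
    rw [Finset.set_biInter_insert, Finset.prod_insert ha, ← ih]
    have hd : Disjoint (B a : Set ℕ) (⋃ k ∈ s, (B k : Set ℕ)) := by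
      simp only [Set.disjoint_iUnion_right]
      intro k hk
      rw [Finset.disjoint_coe]
      exact hB (fun h => ha (h ▸ hk))
    have := ProbabilityTheory.indep_iSup_of_disjoint hle hind hd
    refine (ProbabilityTheory.Indep_iff _ _ _).1 this _ _ (hA a) ?_
    refine Finset.measurableSet_biInter _ (fun k hk => ?_)
    have hle2 : (⨆ i ∈ (B k : Set ℕ), (⊤ : MeasurableSpace Bool).comap (fun X : ℕ → Bool => X i)) ≤
      ⨆ i ∈ (⋃ k ∈ s, (B k : Set ℕ)), (⊤ : MeasurableSpace Bool).comap (fun X : ℕ → Bool => X i) :=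
      biSup_mono (fun i hi => Set.mem_biUnion hk hi)
    exact hle2 _ (hA k)

/-- block sum -/
noncomputable def blockSum (B : Finset ℕ) (X : ℕ → Bool) : ℝ := ∑ i ∈ B, ((X i).toNat : ℝ)

lemma blockSum_meas (B : Finset ℕ) :
    Measurable[⨆ i ∈ (B : Set ℕ), (⊤ : MeasurableSpace Bool).comap (fun X : ℕ → Bool => X i)] (blockSum B) := by
  unfold blockSum
  refine Finset.measurable_fun_sum _ (fun i hi => ?_)
  have h1 : Measurable[⨆ i ∈ (B : Set ℕ), (⊤ : MeasurableSpace Bool).comap (fun X : ℕ → Bool => X i)] (fun X : ℕ → Bool => X i) := by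
    rw [measurable_iff_comap_le]
    exact le_biSup (fun i => (⊤ : MeasurableSpace Bool).comap (fun X : ℕ → Bool => X i)) hi
  exact (measurable_from_top (f := fun b : Bool => (b.toNat : ℝ))).comp h1

lemma blockSum_eq_card (B : Finset ℕ) (X : ℕ → Bool) :
    blockSum B X = ((B.filter (fun i => X i = true)).card : ℝ) := by
  unfold blockSum
  rw [Finset.card_filter]
  push_cast
  refine Finset.sum_congr rfl (fun i _ => ?_)
  cases X i <;> simp

lemma pattern_meas (B T : Finset ℕ) :
    MeasurableSet {X : ℕ → Bool | ∀ i ∈ B, X i = decide (i ∈ T)} := by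
  have : {X : ℕ → Bool | ∀ i ∈ B, X i = decide (i ∈ T)} = ⋂ i ∈ B, (fun X : ℕ → Bool => X i) ⁻¹' {decide (i ∈ T)} := by
    ext X; simp
  rw [this]
  exact Finset.measurableSet_biInter _ (fun i _ => measurable_pi_apply i (measurableSet_singleton _))

lemma block_lower (μ : Measure (ℕ → Bool)) (hμ : IsFairCoin μ) (B : Finset ℕ) (C : Finset ℕ) (a : ℝ)
    (hC : ∀ c ∈ C, a ≤ c) :
    ENNReal.ofReal (∑ c ∈ C, (B.card.choose c : ℝ) / 2 ^ B.card) ≤ μ {X | a ≤ blockSum B X} := by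
  have hsub : (⋃ T ∈ C.biUnion (fun c => B.powersetCard c), {X : ℕ → Bool | ∀ i ∈ B, X i = decide (i ∈ T)}) ⊆ {X | a ≤ blockSum B X} := by
    intro X hX
    simp only [Set.mem_iUnion, Finset.mem_biUnion, Finset.mem_powersetCard] at hX
    obtain ⟨T, ⟨c, hc, hTB, hcard⟩, hX⟩ := hX
    have : B.filter (fun i => X i = true) = T := by
      ext i
      simp only [Finset.mem_filter]
      constructor
      · rintro ⟨h1, h2⟩
        have := hX i h1
        rw [h2] at this
        simpa using this.symm
      · intro h
        refine ⟨hTB h, ?_⟩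
        rw [hX i (hTB h)]; simpa using h
    simp only [Set.mem_ofPred_eq]
    rw [blockSum_eq_card, this, hcard]
    exact hC c hc
  refine le_trans (le_of_eq ?_) (measure_mono hsub)
  rw [measure_biUnion_finset]
  · rw [Finset.sum_congr rfl (fun T _ => hμ.2 B (fun i => decide (i ∈ T)))]
    rw [Finset.sum_const, Finset.card_biUnion]
    · simp only [Finset.card_powersetCard]
      rw [← Finset.sum_div, ENNReal.ofReal_div_of_pos (by positivity), nsmul_eq_mul, ENNReal.div_eq_inv_mul, mul_comm]
      congr 1
      · rw [← Nat.cast_sum, ENNReal.ofReal_natCast]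
      · rw [one_div, ← ENNReal.inv_pow, ENNReal.ofReal_pow (by norm_num)]
        simp
    · intro c _ d _ hcd
      exact Finset.pairwise_disjoint_powersetCard _ hcd
  · intro T hT U hU hTU
    rw [Function.onFun, Set.disjoint_left]
    intro X h1 h2
    apply hTU
    simp only [Finset.coe_biUnion, Set.mem_iUnion, Finset.mem_coe, Finset.mem_powersetCard] at hT hU
    obtain ⟨_, _, hT, _⟩ := hT
    obtain ⟨_, _, hU, _⟩ := hU
    ext i
    by_cases hi : i ∈ B
    · have := (h1 i hi).symm.trans (h2 i hi)
      simpa using this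
    · exact ⟨fun h => absurd (hT h) hi, fun h => absurd (hU h) hi⟩
  · intro T _
    exact pattern_meas B T

lemma coin_chebyshev (μ : Measure (ℕ → Bool)) (hμ : IsFairCoin μ) (n : ℕ) (c : ℝ) (hc : 0 < c) :
    μ {X | c ≤ |coinSum X n - n / 2|} ≤ ENNReal.ofReal (n / c ^ 2) := by
  have := hμ.1
  have hind := fair_iIndepFun μ hμ
  set Y : ℕ → (ℕ → Bool) → ℝ := fun i X => ((X i).toNat : ℝ) with hY
  have hYm : ∀ i, Measurable (Y i) := fun i =>
    (measurable_of_countable (fun b : Bool => (b.toNat : ℝ))).comp (measurable_pi_apply i)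
  have hbd : ∀ i X, Y i X ∈ Set.Icc (0:ℝ) 1 := by
    intro i X
    simp only [hY]
    cases X i <;> simp
  have hL : ∀ i, MemLp (Y i) 2 μ := fun i =>
    MemLp.of_bound (hYm i).aestronglyMeasurable 1 (ae_of_all _ fun X => by
      rw [Real.norm_eq_abs, abs_of_nonneg (hbd i X).1]; exact (hbd i X).2)
  have hmean : ∀ i, ∫ X, Y i X ∂μ = 1/2 := by
    intro i
    have e : Y i = Set.indicator {X : ℕ → Bool | X i = true} 1 := by
      ext X
      simp only [hY, Set.indicator, Set.mem_ofPred_eq]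
      by_cases h : X i = true <;> simp [h]
    have hm : MeasurableSet {X : ℕ → Bool | X i = true} := measurableSet_eq_fun (measurable_pi_apply i) measurable_const
    rw [e, integral_indicator_one hm, Measure.real]
    have := hμ.2 {i} (fun _ => true)
    simp only [Finset.mem_singleton, forall_eq, Finset.card_singleton, pow_one] at this
    rw [this]; simp
  have hsum : (fun X => coinSum X n) = ∑ i ∈ Finset.range n, Y i := by
    ext X; simp [coinSum, hY]
  have hvar : ProbabilityTheory.variance (∑ i ∈ Finset.range n, Y i) μ ≤ n := by
    rw [ProbabilityTheory.IndepFun.variance_sum (fun i _ => hL i)]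
    · calc _ ≤ ∑ i ∈ Finset.range n, (1:ℝ) := by
            refine Finset.sum_le_sum (fun i _ => ?_)
            refine (ProbabilityTheory.variance_le_sq_of_bounded (ae_of_all _ (hbd i)) (hYm i).aemeasurable).trans ?_
            norm_num
        _ = n := by simp
    · intro i _ j _ hij
      exact (hind.indepFun hij).comp (measurable_of_countable (fun b : Bool => (b.toNat : ℝ))) (measurable_of_countable (fun b : Bool => (b.toNat : ℝ)))
  have hL2 : MemLp (∑ i ∈ Finset.range n, Y i) 2 μ := memLp_finsetSum' _ (fun i _ => hL i)
  have hE : ∫ X, (∑ i ∈ Finset.range n, Y i) X ∂μ = n / 2 := by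
    simp only [Finset.sum_apply]
    rw [integral_finsetSum _ (fun i _ => (hL i).integrable (by norm_num))]
    simp [hmean]; ring
  have := ProbabilityTheory.meas_ge_le_variance_div_sq hL2 hc
  rw [hE, ← hsum] at this
  refine this.trans (ENNReal.ofReal_le_ofReal ?_)
  rw [hsum]
  gcongr


/-- block endpoints -/
def NN (k : ℕ) : ℕ := (k+1)^(2*(k+1))

lemma NN_pos (k : ℕ) : 1 ≤ NN k := Nat.one_le_pow _ _ (by omega)

lemma NN_ratio (k : ℕ) : NN k * (k+2)^2 ≤ NN (k+1) := by
  unfold NN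
  have : 2*(k+1+1) = 2*(k+1)+2 := by ring
  rw [this, pow_add]
  gcongr; omega

lemma NN_lt (k : ℕ) : NN k < NN (k+1) := by
  have h := NN_ratio k
  have h2 := NN_pos k
  have h3 : 4 ≤ (k+2)^2 := by nlinarith [Nat.zero_le k, Nat.zero_le (k^2), (by ring : (k+2)^2 = k^2+4*k+4)]
  have h4 := Nat.mul_le_mul_left (NN k) h3
  omega

lemma NN_mono : StrictMono NN := strictMono_nat_of_lt_succ NN_lt

lemma NN_sqrt (k : ℕ) : ((k:ℝ)+2)^2 ≤ Real.sqrt (NN (k+1)) := by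
  apply Real.le_sqrt_of_sq_le
  have : ((k+2)^2)^2 ≤ NN (k+1) := by
    unfold NN
    rw [← pow_mul]
    exact Nat.pow_le_pow_right (by omega) (by omega)
  exact_mod_cast this

lemma log_NN (k : ℕ) : Real.log (2 * (NN (k+1) : ℝ)) = Real.log 2 + 2 * ((k:ℝ)+2) * Real.log ((k:ℝ)+2) := by
  have : (NN (k+1) : ℝ) = ((k:ℝ)+2)^(2*(k+2)) := by
    unfold NN; push_cast; ring_nf
  rw [this, Real.log_mul (by norm_num) (by positivity), Real.log_pow]
  push_cast; ring

lemma L_lower (k : ℕ) : Real.log ((k:ℝ)+2) ≤ Real.log (Real.log (2 * (NN (k+1) : ℝ))) := by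
  apply Real.log_le_log (by positivity)
  rw [log_NN]
  have h1 : (0.69:ℝ) < Real.log 2 := by have := Real.log_two_gt_d9; linarith
  have h2 : Real.log 2 ≤ Real.log ((k:ℝ)+2) := Real.log_le_log (by norm_num) (by linarith [Nat.cast_nonneg (α := ℝ) k])
  have : (0:ℝ) ≤ k := Nat.cast_nonneg k
  nlinarith

lemma tendsto_K : Tendsto (fun k : ℕ => (k:ℝ) + 2) atTop atTop :=
  tendsto_atTop_add_const_right _ _ tendsto_natCast_atTop_atTop

lemma L_upper (c : ℝ) (hc : 1 < c) :
    ∀ᶠ k : ℕ in atTop, Real.log (Real.log (2 * (NN (k+1) : ℝ))) ≤ c * Real.log ((k:ℝ)+2) := by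
  have h := (isLittleO_log_rpow_atTop (show 0 < c - 1 by linarith)).bound (show (0:ℝ) < 1/3 by norm_num)
  filter_upwards [tendsto_K.eventually h] with k hk
  have hk0 : (0:ℝ) ≤ k := Nat.cast_nonneg k
  have h1 : (0.69:ℝ) < Real.log 2 := by have := Real.log_two_gt_d9; linarith
  have h2 : Real.log 2 ≤ Real.log ((k:ℝ)+2) := Real.log_le_log (by norm_num) (by linarith)
  rw [Real.norm_eq_abs, Real.norm_eq_abs, abs_of_nonneg (by linarith), abs_of_nonneg (by positivity)] at hk
  rw [← Real.log_rpow (by positivity)]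
  apply Real.log_le_log
  · rw [log_NN]
    have : 0 ≤ ((k:ℝ)+2) * Real.log ((k:ℝ)+2) := mul_nonneg (by positivity) (by linarith)
    linarith
  · rw [log_NN]
    have e : ((k:ℝ)+2)^c = ((k:ℝ)+2) * ((k:ℝ)+2)^(c-1) := by
      rw [Real.rpow_sub_one (by positivity)]; field_simp
    rw [e]
    have : ((k:ℝ)+2) * (3 * Real.log ((k:ℝ)+2)) ≤ ((k:ℝ)+2) * ((k:ℝ)+2)^(c-1) := by
      gcongr; linarith
    nlinarith

lemma tendsto_sqrtL : Tendsto (fun k : ℕ => Real.sqrt (Real.log (Real.log (2 * (NN (k+1) : ℝ))))) atTop atTop :=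
  Real.tendsto_sqrt_atTop.comp
    (tendsto_atTop_mono L_lower (Real.tendsto_log_atTop.comp tendsto_K))

lemma asym (b : ℝ) (hb0 : 0 < b) (hb : b < 1) :
    ∀ᶠ k : ℕ in atTop,
      (⌈b * Real.sqrt ((NN (k+1):ℝ) * Real.log (Real.log (2 * (NN (k+1) : ℝ))))⌉₊ : ℝ)
        + Real.sqrt ((NN (k+1) - NN k : ℕ) : ℝ) < ((NN (k+1) - NN k : ℕ) : ℝ) ∧
      ((⌈b * Real.sqrt ((NN (k+1):ℝ) * Real.log (Real.log (2 * (NN (k+1) : ℝ))))⌉₊ : ℝ)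
        + Real.sqrt ((NN (k+1) - NN k : ℕ) : ℝ))^2 /
        (((NN (k+1) - NN k : ℕ) : ℝ) - ((⌈b * Real.sqrt ((NN (k+1):ℝ) * Real.log (Real.log (2 * (NN (k+1) : ℝ))))⌉₊ : ℝ)
        + Real.sqrt ((NN (k+1) - NN k : ℕ) : ℝ))) ≤ Real.log ((k:ℝ)+2) := by
  set d := (b+1)/2 with hd
  have hd0 : 0 < d := by linarith
  have hd1 : d < 1 := by linarith
  have hbd : 0 < d - b := by linarith
  filter_upwards [L_upper (1/d) (by rw [lt_div_iff₀ hd0]; linarith),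
    tendsto_sqrtL.eventually_ge_atTop (2/(d-b)),
    tendsto_K.eventually_ge_atTop (1/d),
    tendsto_K.eventually_ge_atTop (2/(1-d))] with k hL hx hK1 hK2
  have hMc : ((NN (k+1) - NN k : ℕ) : ℝ) = (NN (k+1) : ℝ) - NN k := by
    rw [Nat.cast_sub (NN_lt k).le]
  rw [hMc]
  have hlow := L_lower k
  have hsq := NN_sqrt k
  have hrat : (NN k : ℝ) * ((k:ℝ)+2)^2 ≤ NN (k+1) := by exact_mod_cast NN_ratio k
  have hNk : (0:ℝ) < NN k := by exact_mod_cast NN_pos k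
  have hN1 : (0:ℝ) < NN (k+1) := by exact_mod_cast NN_pos (k+1)
  have hltN : (NN k : ℝ) < NN (k+1) := by exact_mod_cast NN_lt k
  set N : ℝ := (NN (k+1) : ℝ)
  set N0 : ℝ := (NN k : ℝ)
  set L := Real.log (Real.log (2 * N))
  have hk0 : (0:ℝ) ≤ k := Nat.cast_nonneg k
  set K : ℝ := (k:ℝ)+2
  have hK : 2 ≤ K := by simp only [K]; linarith
  have hlogK : 0 ≤ Real.log K := Real.log_nonneg (by linarith)
  have hLn : 0 ≤ L := hlogK.trans hlow
  set s := Real.sqrt N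
  set x := Real.sqrt L
  have hs2 : s^2 = N := Real.sq_sqrt hN1.le
  have hx2 : x^2 = L := Real.sq_sqrt hLn
  have hs0 : 0 < s := Real.sqrt_pos.mpr hN1
  have hx0 : 0 ≤ x := Real.sqrt_nonneg _
  have hs1 : 1 ≤ s := by nlinarith
  rw [Real.sqrt_mul hN1.le]
  set J : ℝ := (⌈b * (s * x)⌉₊ : ℝ)
  have hJ : J < b * (s*x) + 1 := Nat.ceil_lt_add_one (by positivity)
  have hJ0 : 0 ≤ J := Nat.cast_nonneg _
  have hM : Real.sqrt (N - N0) ≤ s := Real.sqrt_le_sqrt (by linarith)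
  have hM0 : 0 ≤ Real.sqrt (N - N0) := Real.sqrt_nonneg _
  set r := Real.sqrt (N - N0)
  rw [div_le_iff₀ hbd] at hx
  have hup : J + r ≤ s * (d * x) := by nlinarith
  have hxK : x ≤ K := by
    have h1 : L ≤ K^2 := by
      have h3 : Real.log K ≤ K := (Real.log_le_sub_one_of_pos (by linarith)).trans (by linarith)
      calc L ≤ 1/d * Real.log K := hL
        _ ≤ K * K := by gcongr
        _ = K^2 := by ring
    rw [← hx2] at h1
    exact le_of_sq_le_sq h1 (by linarith)
  have hlowM : d * N ≤ N - N0 - (J + r) := by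
    rw [div_le_iff₀ (by linarith)] at hK2
    have h1 : s * (d * x) * K ≤ N := by
      rw [← hs2]
      have : d * x * K ≤ s := by
        have : d * x * K ≤ 1 * K * K := by gcongr
        nlinarith
      nlinarith
    have h2 : N0 * K ≤ N := by nlinarith
    have h3 : (N0 + s * (d*x)) * K ≤ ((1-d) * N) * K := by nlinarith
    have h4 := le_of_mul_le_mul_right h3 (by linarith)
    linarith
  have hdN : 0 < d * N := by positivity
  refine ⟨by linarith, ?_⟩
  calc (J+r)^2/(N - N0 - (J+r)) ≤ (s * (d*x))^2/(d*N) := by gcongr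
    _ = d * L := by rw [mul_pow, mul_pow, hs2, hx2]; field_simp
    _ ≤ d * (1/d * Real.log K) := by gcongr
    _ = Real.log K := by field_simp


/-- the blocks -/
def BB (k : ℕ) : Finset ℕ := Finset.Ico (2 * NN k) (2 * NN (k+1))

lemma BB_card (k : ℕ) : (BB k).card = 2 * (NN (k+1) - NN k) := by
  unfold BB; rw [Nat.card_Ico]; omega

lemma BB_disj : Pairwise (Function.onFun Disjoint BB) := by
  have h : ∀ i j, i < j → Disjoint (BB i) (BB j) := by
    intro i j hij
    rw [Finset.disjoint_left]
    intro x hx hy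
    simp only [BB, Finset.mem_Ico] at hx hy
    have : NN (i+1) ≤ NN j := NN_mono.monotone hij
    omega
  intro i j hij
  rcases lt_or_gt_of_ne hij with h1 | h1
  · exact h i j h1
  · exact (h j i h1).symm

lemma coinSum_split (X : ℕ → Bool) (k : ℕ) :
    coinSum X (2 * NN (k+1)) = coinSum X (2 * NN k) + blockSum (BB k) X := by
  unfold coinSum blockSum BB
  rw [Finset.sum_range_add_sum_Ico]
  have := NN_lt k
  omega

lemma good_ae (μ : Measure (ℕ → Bool)) (hμ : IsFairCoin μ) :
    ∀ᵐ X ∂μ, ∀ᶠ k : ℕ in atTop,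
      |coinSum X (2 * NN k) - NN k| < Real.sqrt (2 * NN (k+1)) := by
  have hb : ∀ k : ℕ, μ {X | Real.sqrt (2 * NN (k+1)) ≤ |coinSum X (2 * NN k) - ((2 * NN k : ℕ) : ℝ) / 2|} ≤
      ENNReal.ofReal (1 / ((k+1 : ℕ) : ℝ)^2) := by
    intro k
    have hN1 : (0:ℝ) < NN (k+1) := by exact_mod_cast NN_pos (k+1)
    refine (coin_chebyshev μ hμ (2 * NN k) _ (Real.sqrt_pos.mpr (by positivity))).trans ?_
    apply ENNReal.ofReal_le_ofReal
    rw [Real.sq_sqrt (by positivity), div_le_div_iff₀ (by positivity) (by positivity)]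
    have hrat : (NN k : ℝ) * ((k:ℝ)+2)^2 ≤ NN (k+1) := by exact_mod_cast NN_ratio k
    have : (NN k : ℝ) * ((k:ℝ)+1)^2 ≤ (NN k : ℝ) * ((k:ℝ)+2)^2 := by gcongr; norm_num
    push_cast
    linarith
  have hs : Summable (fun k : ℕ => 1 / ((k+1 : ℕ) : ℝ)^2) :=
    (summable_nat_add_iff 1).mpr (Real.summable_one_div_nat_pow.mpr (by norm_num : 1 < 2))
  have hfin : ∑' k : ℕ, μ {X | Real.sqrt (2 * NN (k+1)) ≤ |coinSum X (2 * NN k) - ((2 * NN k : ℕ) : ℝ) / 2|} ≠ ⊤ :=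
    ne_top_of_le_ne_top hs.tsum_ofReal_ne_top (ENNReal.tsum_le_tsum hb)
  filter_upwards [ae_eventually_notMem hfin] with X hX
  filter_upwards [hX] with k hk
  rw [not_le] at hk
  push_cast at hk
  rwa [mul_div_cancel_left₀ _ (by norm_num)] at hk

/-- the block deviation threshold -/
noncomputable def thr (b : ℝ) (k : ℕ) : ℕ :=
  ⌈b * Real.sqrt ((NN (k+1):ℝ) * Real.log (Real.log (2 * (NN (k+1) : ℝ))))⌉₊

lemma block_prob (μ : Measure (ℕ → Bool)) (hμ : IsFairCoin μ) (b : ℝ) (hb0 : 0 < b) (hb : b < 1) :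
    ∀ᶠ k : ℕ in atTop, ENNReal.ofReal (1 / 2 * (1 / ((k + 2 : ℕ) : ℝ))) ≤
      μ {X | (((NN (k+1) - NN k) + thr b k : ℕ) : ℝ) ≤ blockSum (BB k) X} := by
  filter_upwards [asym b hb0 hb] with k hk
  obtain ⟨h1, h2⟩ := hk
  change (thr b k : ℝ) + _ < _ at h1
  change ((thr b k : ℝ) + _)^2 / (_ - ((thr b k : ℝ) + _)) ≤ _ at h2
  have hM : 1 ≤ NN (k+1) - NN k := by have := NN_lt k; omega
  set M := NN (k+1) - NN k with hMdef
  have h3 := sum_lower M (thr b k) hM h1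
  have h4 := block_lower μ hμ (BB k) (Finset.Ico (M + thr b k) (M + thr b k + (Nat.sqrt M + 1)))
    ((M + thr b k : ℕ) : ℝ) (by
      intro c hc
      rw [Finset.mem_Ico] at hc
      exact_mod_cast hc.1)
  refine le_trans (ENNReal.ofReal_le_ofReal ?_) h4
  rw [BB_card, ← hMdef]
  have e : (2:ℝ)^(2*M) = 4^M := by rw [pow_mul]; norm_num
  rw [e]
  refine le_trans ?_ h3
  have h5 : (1 / ((k + 2 : ℕ) : ℝ)) = Real.exp (- Real.log ((k:ℝ)+2)) := by
    rw [Real.exp_neg, Real.exp_log (by positivity)]; push_cast; simp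
  rw [h5]
  gcongr
  rw [neg_div]
  exact neg_le_neg h2

lemma block_io (μ : Measure (ℕ → Bool)) (hμ : IsFairCoin μ) (b : ℝ) (hb0 : 0 < b) (hb : b < 1) :
    ∀ᵐ X ∂μ, ∃ᶠ k : ℕ in atTop,
      (((NN (k+1) - NN k) + thr b k : ℕ) : ℝ) ≤ blockSum (BB k) X := by
  have := hμ.1
  set A : ℕ → Set (ℕ → Bool) := fun k => {X | (((NN (k+1) - NN k) + thr b k : ℕ) : ℝ) ≤ blockSum (BB k) X} with hA
  have hAm0 : ∀ k, MeasurableSet[⨆ i ∈ (BB k : Set ℕ), (⊤ : MeasurableSpace Bool).comap (fun X : ℕ → Bool => X i)] (A k) :=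
    fun k => (blockSum_meas (BB k)) measurableSet_Ici
  have hle : ∀ i : ℕ, (⊤ : MeasurableSpace Bool).comap (fun X : ℕ → Bool => X i) ≤ MeasurableSpace.pi := fun i =>
    (measurable_pi_apply i).comap_le
  have hAm : ∀ k, MeasurableSet (A k) := fun k => (iSup₂_le (fun i _ => hle i)) _ (hAm0 k)
  have hind := blocks_iIndepSet μ hμ BB BB_disj A hAm0
  have hsum : ∑' k, μ (A k) = ⊤ := by
    by_contra hne
    obtain ⟨k0, hk0⟩ := eventually_atTop.mp (block_prob μ hμ b hb0 hb)
    have hs : Summable (fun k => (μ (A k)).toReal) := ENNReal.summable_toReal hne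
    have hs2 : Summable (fun k => (μ (A (k + k0))).toReal) := (summable_nat_add_iff k0).mpr hs
    have hs3 : Summable (fun k : ℕ => 1 / 2 * (1 / ((k + k0 + 2 : ℕ) : ℝ))) := by
      refine Summable.of_nonneg_of_le (fun k => by positivity) (fun k => ?_) hs2
      exact (ENNReal.ofReal_le_iff_le_toReal (measure_ne_top _ _)).mp (hk0 (k + k0) (by omega))
    have hs4 : Summable (fun k : ℕ => (1 / ((k + k0 + 2 : ℕ) : ℝ))) :=
      (summable_mul_left_iff (by norm_num)).mp hs3
    have hs5 : Summable (fun k : ℕ => 1 / (k : ℝ)) := (summable_nat_add_iff (k0+2)).mp hs4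
    exact Real.not_summable_one_div_natCast hs5
  have h1 := ProbabilityTheory.measure_limsup_eq_one hAm hind hsum
  have h2 : ∀ᵐ X ∂μ, X ∈ limsup A atTop :=
    (mem_ae_iff_prob_eq_one (MeasurableSet.measurableSet_limsup hAm)).mpr h1
  filter_upwards [h2] with X hX
  exact mem_limsup_iff_frequently_mem.mp hX

lemma lil_fixed (μ : Measure (ℕ → Bool)) (hμ : IsFairCoin μ) (a : ℝ) (ha0 : 0 < a) (ha : a < 1) :
    ∀ᵐ X ∂μ,
      {n : ℕ | n / 2 + a * Real.sqrt ((n / 2) * Real.log (Real.log n)) < coinSum X n}.Infinite := by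
  set b := (a+1)/2 with hb
  have hb0 : 0 < b := by linarith
  have hb1 : b < 1 := by linarith
  have hba : 0 < b - a := by linarith
  filter_upwards [good_ae μ hμ, block_io μ hμ b hb0 hb1] with X hg hio
  rw [← Nat.frequently_atTop_iff_infinite]
  have ht : Tendsto (fun k => 2 * NN (k+1)) atTop atTop := by
    refine tendsto_atTop_mono (fun k => ?_) tendsto_id
    have := NN_mono.id_le (k+1)
    simp only [id] at *
    omega
  refine ht.frequently ?_
  refine (hio.and_eventually (hg.and (tendsto_sqrtL.eventually_gt_atTop (2/(b-a))))).mono ?_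
  rintro k ⟨h1, h2, h3⟩
  rw [coinSum_split]
  have hltN : (NN k : ℝ) < NN (k+1) := by exact_mod_cast NN_lt k
  have hN1 : (0:ℝ) < NN (k+1) := by exact_mod_cast NN_pos (k+1)
  have hthr : b * Real.sqrt ((NN (k+1):ℝ) * Real.log (Real.log (2 * (NN (k+1) : ℝ)))) ≤ thr b k := Nat.le_ceil _
  rw [Nat.cast_add, Nat.cast_sub (NN_lt k).le] at h1
  push_cast
  rw [mul_div_cancel_left₀ _ (by norm_num : (2:ℝ) ≠ 0)]
  have h4 := (abs_lt.mp h2).1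
  rw [Real.sqrt_mul hN1.le] at hthr ⊢
  set s := Real.sqrt (NN (k+1) : ℝ)
  set x := Real.sqrt (Real.log (Real.log (2 * (NN (k+1) : ℝ))))
  have hs0 : 0 < s := Real.sqrt_pos.mpr hN1
  have h5 : Real.sqrt (2 * NN (k+1)) ≤ 2 * s := by
    rw [Real.sqrt_mul (by norm_num)]
    have : Real.sqrt 2 ≤ 2 := Real.sqrt_le_iff.mpr (by norm_num)
    gcongr
  rw [div_lt_iff₀ hba] at h3
  nlinarith

/-- Lower half of the Law of the Iterated Logarithm: for `μ`-almost every `X`,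
for every `λ < 1` there are infinitely many `n` with
`S_n(X) > n/2 + λ √((n/2) log log n)`. -/
theorem lil_lower (μ : Measure (ℕ → Bool)) (hμ : IsFairCoin μ) :
    ∀ᵐ X ∂μ, ∀ lam : ℝ, lam < 1 →
      {n : ℕ | n / 2 + lam * Real.sqrt ((n / 2) * Real.log (Real.log n)) < coinSum X n}.Infinite := by
  have h : ∀ᵐ X ∂μ, ∀ j : ℕ,
      {n : ℕ | n / 2 + (1 - 1 / ((j:ℝ)+2)) * Real.sqrt ((n / 2) * Real.log (Real.log n)) < coinSum X n}.Infinite := by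
    rw [ae_all_iff]
    intro j
    have hj : (0:ℝ) ≤ j := Nat.cast_nonneg j
    have h1 : 1 / ((j:ℝ)+2) < 1 := by rw [div_lt_one (by positivity)]; linarith
    have h2 : 0 < 1 / ((j:ℝ)+2) := by positivity
    exact lil_fixed μ hμ _ (by linarith) (by linarith)
  filter_upwards [h] with X hX lam hlam
  obtain ⟨j, hj⟩ := exists_nat_one_div_lt (sub_pos.mpr hlam)
  refine (hX j).mono (fun n hn => ?_)
  rw [Set.mem_ofPred_eq] at hn ⊢
  refine lt_of_le_of_lt ?_ hn
  have : 1 / ((j:ℝ)+2) ≤ 1 / ((j:ℝ)+1) := by gcongr; norm_num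
  gcongr
  linarith
end
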